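/- arXiv:1105.2648 — 3 statements merged into one kernel-verified Lean document; each statement's English description precedes it below -/
import Mathlib

section
/- Let h : ℂ ∖ {0,1} → ℂ ∖ {0,1} be a holomorphic map which is not proper as a map from ℂ ∖ {0,1} to itself (i.e., there is a compact subset of ℂ ∖ {0,1} whose preimage under h is not compact). Then h is constant. -/
open Set

theorem aux_log {f : ℂ → ℂ} {c : ℂ} {R : ℝ} (hR : 0 < R)
    (hf : DifferentiableOn ℂ f (Metric.ball c R)) (h0 : ∀ z ∈ Metric.ball c R, f z ≠ 0) :
    ∃ L : ℂ → ℂ, DifferentiableOn ℂ L (Metric.ball c R) ∧ L c = Complex.log (f c) ∧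
      ∀ z ∈ Metric.ball c R, Complex.exp (L z) = f z := by
  have hc : c ∈ Metric.ball c R := Metric.mem_ball_self hR
  have hd : DifferentiableOn ℂ (fun z => deriv f z / f z) (Metric.ball c R) :=
    (hf.deriv Metric.isOpen_ball).div hf h0
  obtain ⟨L, hLc, hL⟩ := hd.isExactOn_ball.with_val_at c (Complex.log (f c))
  refine ⟨L, fun z hz => (hL z hz).differentiableAt.differentiableWithinAt, hLc, ?_⟩
  have key : ∀ z ∈ Metric.ball c R,
      HasDerivAt (fun z => f z * Complex.exp (-L z)) 0 z := by
    intro z hz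
    have h1 : HasDerivAt f (deriv f z) z :=
      (hf.differentiableAt (Metric.isOpen_ball.mem_nhds hz)).hasDerivAt
    have h2 : HasDerivAt (fun z => f z * Complex.exp (-L z))
        (deriv f z * Complex.exp (-L z) + f z * (Complex.exp (-L z) * -(deriv f z / f z))) z :=
      h1.mul (hL z hz).neg.cexp
    have h3 : f z * (deriv f z / f z) = deriv f z := mul_div_cancel₀ _ (h0 z hz)
    have h4 : deriv f z * Complex.exp (-L z) +
        f z * (Complex.exp (-L z) * -(deriv f z / f z)) = 0 := by
      linear_combination -Complex.exp (-L z) * h3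
    rwa [h4] at h2
  intro z hz
  have h := Metric.isOpen_ball.is_const_of_deriv_eq_zero (convex_ball c R).isPreconnected
    (fun z hz => (key z hz).differentiableAt.differentiableWithinAt)
    (fun z hz => (key z hz).deriv) hz hc
  simp only [hLc] at h
  rw [Complex.exp_neg, Complex.exp_neg, Complex.exp_log (h0 c hc),
    mul_inv_cancel₀ (h0 c hc)] at h
  have := Complex.exp_ne_zero (L z)
  field_simp at h
  exact h.symm

theorem aux_bloch_local {g : ℂ → ℂ} {a : ℂ} {t : ℝ} (ht : 0 < t)
    (hg : DifferentiableOn ℂ g (Metric.ball a t)) (hne : deriv g a ≠ 0)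
    (hb : ∀ z ∈ Metric.ball a t, ‖deriv g z‖ ≤ 2 * ‖deriv g a‖) :
    Metric.ball (g a) (‖deriv g a‖ * t / 24) ⊆ g '' Metric.ball a t := by
  set m := ‖deriv g a‖ with hm
  have hm0 : 0 < m := norm_pos_iff.2 hne
  have hsub : Metric.closedBall a (t/6) ⊆ Metric.ball a t :=
    Metric.closedBall_subset_ball (by linarith)
  have hs : ∀ z ∈ Metric.ball a t, dist (deriv g z) (deriv g a) ≤ 3 * m / t * dist z a := by
    intro z hz
    refine Complex.dist_le_div_mul_dist_of_mapsTo_ball (hg.deriv Metric.isOpen_ball) ?_ hz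
    intro y hy
    rw [Metric.mem_closedBall, dist_eq_norm]
    calc _ ≤ ‖deriv g y‖ + ‖deriv g a‖ := norm_sub_le _ _
      _ ≤ _ := by linarith [hb y hy]
  have hD : ∀ z ∈ Metric.ball a t, HasDerivAt g (deriv g z) z := fun z hz =>
    (hg.differentiableAt (Metric.isOpen_ball.mem_nhds hz)).hasDerivAt
  have hmv : ∀ z ∈ Metric.closedBall a (t/6),
      ‖(g z - deriv g a * z) - (g a - deriv g a * a)‖ ≤ m / 2 * ‖z - a‖ := by
    intro z hz
    refine (convex_closedBall a (t/6)).norm_image_sub_le_of_norm_hasDerivWithin_le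
      (f := fun z => g z - deriv g a * z) (f' := fun z => deriv g z - deriv g a) ?_ ?_
      (Metric.mem_closedBall_self (by positivity)) hz
    · intro y hy
      have := (hD y (hsub hy)).sub ((hasDerivAt_id y).const_mul (deriv g a))
      simp only [mul_one] at this
      exact this.hasDerivWithinAt
    · intro y hy
      rw [← dist_eq_norm]
      refine (hs y (hsub hy)).trans ?_
      rw [Metric.mem_closedBall] at hy
      calc 3 * m / t * dist y a ≤ 3 * m / t * (t/6) := by gcongr
        _ = m / 2 := by field_simp; norm_num
  have hlow : ∀ z ∈ Metric.closedBall a (t/6), m / 2 * ‖z - a‖ ≤ ‖g z - g a‖ := by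
    intro z hz
    have h1 := hmv z hz
    have h2 : deriv g a * (z - a) = (g z - g a) - ((g z - deriv g a * z) - (g a - deriv g a * a)) := by
      ring
    have h3 : m * ‖z - a‖ ≤ ‖g z - g a‖ + ‖(g z - deriv g a * z) - (g a - deriv g a * a)‖ := by
      rw [hm, ← norm_mul, h2]; exact norm_sub_le _ _
    linarith
  have := DiffContOnCl.ball_subset_image_closedBall (f := g) (z₀ := a) (r := t/6)
    (ε := m * t / 12) (hg.diffContOnCl_ball hsub) (by positivity) ?_ ?_
  · refine (subset_trans ?_ this).trans (image_mono hsub)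
    apply Metric.ball_subset_ball
    linarith
  · intro z hz
    have := hlow z (Metric.sphere_subset_closedBall hz)
    rw [mem_sphere_iff_norm] at hz
    rw [hz] at this
    linarith
  · have : ∀ᶠ z in nhdsWithin a {a}ᶜ, g z ≠ g a := by
      have hn : Metric.closedBall a (t/6) ∈ nhdsWithin a {a}ᶜ :=
        mem_nhdsWithin_of_mem_nhds (Metric.closedBall_mem_nhds a (by positivity))
      filter_upwards [hn, self_mem_nhdsWithin] with z hz hza he
      have := hlow z hz
      rw [he, sub_self, norm_zero] at this
      have h4 : 0 < ‖z - a‖ := norm_pos_iff.2 (sub_ne_zero.2 hza)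
      nlinarith
    exact this.frequently.filter_mono nhdsWithin_le_nhds

theorem aux_bloch {g : ℂ → ℂ} {c : ℂ} {R : ℝ} (hR : 0 < R)
    (hg : DifferentiableOn ℂ g (Metric.ball c R)) :
    ∃ w, Metric.ball w (‖deriv g c‖ * R / 96) ⊆ g '' Metric.ball c R := by
  by_cases h0 : deriv g c = 0
  · exact ⟨0, by simp [h0]⟩
  have hm : 0 < ‖deriv g c‖ := norm_pos_iff.2 h0
  have hsub : Metric.closedBall c (R/2) ⊆ Metric.ball c R :=
    Metric.closedBall_subset_ball (by linarith)
  have hcont : ContinuousOn (fun z => ‖deriv g z‖ * (R/2 - dist z c)) (Metric.closedBall c (R/2)) :=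
    (((hg.deriv Metric.isOpen_ball).continuousOn.mono hsub).norm).mul (by fun_prop)
  have hcm : c ∈ Metric.closedBall c (R/2) := Metric.mem_closedBall_self (by positivity)
  obtain ⟨a, ha, hmax⟩ := (isCompact_closedBall c (R/2)).exists_isMaxOn ⟨c, hcm⟩ hcont
  have hφ : ‖deriv g c‖ * (R/2) ≤ ‖deriv g a‖ * (R/2 - dist a c) := by
    simpa using hmax hcm
  have hpos : 0 < ‖deriv g a‖ * (R/2 - dist a c) := lt_of_lt_of_le (by positivity) hφ
  have hga : 0 < ‖deriv g a‖ := by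
    rcases (norm_nonneg (deriv g a)).lt_or_eq with h | h
    · exact h
    · rw [← h] at hpos; simp at hpos
  have hda : 0 < R/2 - dist a c := by
    by_contra h; nlinarith
  set t := (R/2 - dist a c)/2 with ht
  have ht0 : 0 < t := by positivity
  have hin : Metric.ball a t ⊆ Metric.closedBall c (R/2) := by
    intro z hz
    rw [Metric.mem_ball] at hz
    rw [Metric.mem_closedBall]
    linarith [dist_triangle z a c]
  have := aux_bloch_local ht0 (hg.mono (hin.trans hsub)) (norm_pos_iff.1 hga) ?_
  · refine ⟨g a, (subset_trans ?_ this).trans (image_mono (hin.trans hsub))⟩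
    apply Metric.ball_subset_ball
    rw [ht]; linarith
  · intro z hz
    have h1 : ‖deriv g z‖ * (R/2 - dist z c) ≤ ‖deriv g a‖ * (R/2 - dist a c) := hmax (hin hz)
    rw [Metric.mem_ball] at hz
    have h2 : t ≤ R/2 - dist z c := by linarith [dist_triangle z a c]
    have h3 : ‖deriv g z‖ * t ≤ (2 * ‖deriv g a‖) * t := by
      calc _ ≤ ‖deriv g z‖ * (R/2 - dist z c) := by gcongr
        _ ≤ _ := by rw [ht]; linarith
    exact le_of_mul_le_mul_right h3 ht0

theorem aux_real (x : ℝ) : ∃ s, |s - x| ≤ 2 ∧ ∃ n : ℕ, Real.cosh s ^ 2 = n := by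
  have key : ∀ x : ℝ, 0 ≤ x → ∃ s, |s - x| ≤ 2 ∧ ∃ n : ℕ, Real.cosh s ^ 2 = n := by
    intro x hx
    have h1 : Real.cosh x ^ 2 + 1 ≤ Real.cosh (x + 2) ^ 2 := by
      have hs : 2 ≤ Real.sinh 2 := Real.self_le_sinh_iff.2 (by norm_num)
      have hc : 1 ≤ Real.cosh 2 := Real.one_le_cosh 2
      have hcx : 1 ≤ Real.cosh x := Real.one_le_cosh x
      have hsx : 0 ≤ Real.sinh x := Real.sinh_nonneg_iff.2 hx
      have h2 : Real.cosh x + 1 ≤ Real.cosh (x + 2) := by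
        rw [Real.cosh_add]
        have h5 : Real.cosh 2 ^ 2 = Real.sinh 2 ^ 2 + 1 := Real.cosh_sq 2
        have h6 : 2 ≤ Real.cosh 2 := by nlinarith
        nlinarith [mul_nonneg hsx (by linarith : 0 ≤ Real.sinh 2)]
      nlinarith
    obtain ⟨n, hn⟩ : ∃ n : ℕ, (n:ℝ) = ⌈Real.cosh x ^ 2⌉₊ := ⟨_, rfl⟩
    have hn1 : Real.cosh x ^ 2 ≤ n := by rw [hn]; exact Nat.le_ceil _
    have hn2 : (n:ℝ) ≤ Real.cosh (x+2) ^ 2 := by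
      rw [hn]; exact (Nat.ceil_lt_add_one (by positivity)).le.trans h1
    obtain ⟨s, hs, hs2⟩ := intermediate_value_Icc (by linarith : x ≤ x + 2)
      (f := fun y => Real.cosh y ^ 2) (by fun_prop) ⟨hn1, hn2⟩
    refine ⟨s, ?_, n, hs2⟩
    rw [abs_le]; constructor <;> linarith [hs.1, hs.2]
  rcases le_total 0 x with hx | hx
  · exact key x hx
  · obtain ⟨s, h1, n, h2⟩ := key (-x) (by linarith)
    refine ⟨-s, ?_, n, by rwa [Real.cosh_neg]⟩
    rw [← abs_neg]; convert h1 using 2; ring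

theorem aux_dense (w : ℂ) : ∃ p, dist p w < 4 ∧ ∃ n : ℕ, Complex.cosh p ^ 2 = n := by
  obtain ⟨s, h1, n, h2⟩ := aux_real w.re
  set k : ℤ := round (w.im / Real.pi) with hk
  have hpi := Real.pi_pos
  have hk1 : |w.im - k * Real.pi| ≤ Real.pi / 2 := by
    have h3 : |w.im / Real.pi - k| ≤ 1 / 2 := abs_sub_round _
    have h4 : w.im - k * Real.pi = (w.im / Real.pi - k) * Real.pi := by field_simp
    rw [h4, abs_mul, abs_of_pos hpi]
    nlinarith
  refine ⟨(s : ℂ) + (k * Real.pi : ℂ) * Complex.I, ?_, n, ?_⟩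
  · rw [dist_eq_norm]
    refine (Complex.norm_le_abs_re_add_abs_im _).trans_lt ?_
    have e1 : ((s : ℂ) + (k * Real.pi : ℂ) * Complex.I - w).re = s - w.re := by simp
    have e2 : ((s : ℂ) + (k * Real.pi : ℂ) * Complex.I - w).im = -(w.im - k * Real.pi) := by
      simp
    rw [e1, e2, abs_neg]
    linarith [Real.pi_lt_d2]
  · have h5 : (Complex.cosh s) ^ 2 = n := by exact_mod_cast congrArg (fun x : ℝ => (x : ℂ)) h2
    have h6 := Complex.sin_sq_add_cos_sq (k * Real.pi : ℂ)
    rw [Complex.cosh_add, Complex.cosh_mul_I, Complex.sinh_mul_I, Complex.sin_int_mul_pi]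
    rw [Complex.sin_int_mul_pi] at h6
    rw [← h5]
    linear_combination Complex.cosh s ^ 2 * h6

theorem aux_log_norm {w : ℂ} {B : ℝ} (h0 : w ≠ 0) (h1 : ‖w‖ ≤ B) (h2 : ‖w⁻¹‖ ≤ B) :
    ‖Complex.log w‖ ≤ B + 4 := by
  have hw : 0 < ‖w‖ := norm_pos_iff.2 h0
  refine (Complex.norm_le_abs_re_add_abs_im _).trans ?_
  rw [Complex.log_re, Complex.log_im]
  have h3 := Complex.abs_arg_le_pi w
  have h4 : |Real.log ‖w‖| ≤ B := by
    rw [abs_le]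
    constructor
    · have := Real.log_le_self (norm_nonneg w⁻¹)
      rw [norm_inv, Real.log_inv] at this
      rw [norm_inv] at h2
      linarith
    · exact (Real.log_le_self (norm_nonneg w)).trans h1
  linarith [Real.pi_lt_d2]

theorem aux_schottky (A : ℝ) : ∃ C : ℝ, ∀ (f : ℂ → ℂ) (c : ℂ) (R : ℝ), 0 < R →
    DifferentiableOn ℂ f (Metric.ball c R) →
    (∀ z ∈ Metric.ball c R, f z ≠ 0 ∧ f z ≠ 1) → ‖Complex.log (f c)‖ ≤ A →
    ∀ z ∈ Metric.ball c (R/2), ‖f z‖ ≤ C := by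
  refine ⟨Real.exp (2 * Real.pi * Real.exp (2 * A + 391) ^ 2), ?_⟩
  intro f c R hR hf h01 hA
  have hc : c ∈ Metric.ball c R := Metric.mem_ball_self hR
  have hA0 : 0 ≤ A := (norm_nonneg _).trans hA
  have hpi := Real.pi_gt_three
  have hpiI : (2 * Real.pi * Complex.I : ℂ) ≠ 0 := Complex.two_pi_I_ne_zero
  have hnpiI : ‖(2 * Real.pi * Complex.I : ℂ)‖ = 2 * Real.pi := by
    simp [abs_of_pos Real.pi_pos]
  obtain ⟨L, hLd, hLc, hL⟩ := aux_log hR hf (fun z hz => (h01 z hz).1)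
  set F : ℂ → ℂ := fun z => L z / (2 * Real.pi * Complex.I) with hF
  have hFL : ∀ z, L z = F z * (2 * Real.pi * Complex.I) := fun z => by
    simp only [hF]; field_simp
  have hFd : DifferentiableOn ℂ F (Metric.ball c R) := hLd.div_const _
  have hFn : ∀ z ∈ Metric.ball c R, ∀ n : ℕ, F z ≠ n := by
    intro z hz n hn
    have h1 := hL z hz
    rw [hFL, hn, Complex.exp_nat_mul_two_pi_mul_I] at h1
    exact (h01 z hz).2 h1.symm
  obtain ⟨l1, hl1d, -, hl1⟩ := aux_log hR hFd (fun z hz => by simpa using hFn z hz 0)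
  obtain ⟨l2, hl2d, -, hl2⟩ := aux_log (f := fun z => F z - 1) hR (hFd.sub_const 1)
    (fun z hz => sub_ne_zero.2 (by simpa using hFn z hz 1))
  set u : ℂ → ℂ := fun z => Complex.exp (l1 z / 2) with hu
  set v : ℂ → ℂ := fun z => Complex.exp (l2 z / 2) with hv
  have hud : DifferentiableOn ℂ u (Metric.ball c R) := (hl1d.div_const 2).cexp
  have hvd : DifferentiableOn ℂ v (Metric.ball c R) := (hl2d.div_const 2).cexp
  have hu2 : ∀ z ∈ Metric.ball c R, u z ^ 2 = F z := by
    intro z hz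
    rw [← hl1 z hz, hu, ← Complex.exp_nat_mul]; congr 1; push_cast; ring
  have hv2 : ∀ z ∈ Metric.ball c R, v z ^ 2 = F z - 1 := by
    intro z hz
    rw [← hl2 z hz, hv, ← Complex.exp_nat_mul]; congr 1; push_cast; ring
  have huv : ∀ z ∈ Metric.ball c R, (u z + v z) * (u z - v z) = 1 := by
    intro z hz
    linear_combination hu2 z hz - hv2 z hz
  have huv0 : ∀ z ∈ Metric.ball c R, u z + v z ≠ 0 := fun z hz h => by
    have := huv z hz
    rw [h] at this; simp at this
  obtain ⟨g, hgd, hgc, hg⟩ := aux_log (f := fun z => u z + v z) hR (hud.add hvd) huv0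
  have hcosh : ∀ z ∈ Metric.ball c R, Complex.cosh (g z) ^ 2 = F z := by
    intro z hz
    have h1 : Complex.exp (-g z) = u z - v z := by
      rw [Complex.exp_neg, hg z hz]
      exact inv_eq_of_mul_eq_one_right (huv z hz)
    rw [Complex.cosh, hg z hz, h1, ← hu2 z hz]; ring
  -- bound at the centre
  have hFc : ‖F c‖ ≤ A := by
    simp only [hF]
    rw [norm_div, hnpiI, hLc, div_le_iff₀ (by positivity)]
    nlinarith
  have huc : ‖u c‖ ≤ A + 1 := by
    have : ‖u c‖ ^ 2 ≤ A := by rw [← norm_pow, hu2 c hc]; exact hFc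
    nlinarith [norm_nonneg (u c)]
  have hvc : ‖v c‖ ≤ A + 2 := by
    have : ‖v c‖ ^ 2 ≤ A + 1 := by
      rw [← norm_pow, hv2 c hc]
      refine (norm_sub_le _ _).trans ?_
      rw [norm_one]; linarith
    nlinarith [norm_nonneg (v c)]
  have hgcb : ‖g c‖ ≤ 2 * A + 7 := by
    rw [hgc]
    have h1 : ‖u c + v c‖ ≤ 2 * A + 3 := (norm_add_le _ _).trans (by linarith)
    have h2 : ‖(u c + v c)⁻¹‖ ≤ 2 * A + 3 := by
      rw [inv_eq_of_mul_eq_one_right (huv c hc)]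
      exact (norm_sub_le _ _).trans (by linarith)
    exact (aux_log_norm (huv0 c hc) h1 h2).trans (by linarith)
  -- derivative bound
  have hsub : Metric.ball c (R/2) ⊆ Metric.ball c R := Metric.ball_subset_ball (by linarith)
  have hgb : ∀ z ∈ Metric.ball c (R/2), ‖deriv g z‖ ≤ 768 / R := by
    intro z hz
    have hzs : Metric.ball z (R/2) ⊆ Metric.ball c R := by
      apply Metric.ball_subset_ball'
      rw [Metric.mem_ball] at hz; linarith
    obtain ⟨w, hw⟩ := aux_bloch (by positivity : 0 < R/2) (hgd.mono hzs)
    by_contra hcon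
    push Not at hcon
    rw [div_lt_iff₀ hR] at hcon
    obtain ⟨p, hp, n, hn⟩ := aux_dense w
    obtain ⟨y, hy, hyp⟩ := hw (Metric.mem_ball.2 (hp.trans (by linarith)))
    have := hcosh y (hzs hy)
    rw [hyp, hn] at this
    exact hFn y (hzs hy) n this.symm
  intro z hz
  have hmv : ‖g z - g c‖ ≤ 768 / R * ‖z - c‖ := by
    refine (convex_ball c (R/2)).norm_image_sub_le_of_norm_deriv_le (fun y hy => ?_) hgb
      (Metric.mem_ball_self (by positivity)) hz
    exact hgd.differentiableAt (Metric.isOpen_ball.mem_nhds (hsub hy))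
  have hzc : ‖z - c‖ ≤ R / 2 := by
    rw [← dist_eq_norm]; exact (Metric.mem_ball.1 hz).le
  have hgz : ‖g z‖ ≤ 2 * A + 391 := by
    have h1 : 768 / R * ‖z - c‖ ≤ 384 := by
      calc _ ≤ 768 / R * (R/2) := by gcongr
        _ = 384 := by field_simp; norm_num
    have h2 : ‖g z‖ ≤ ‖g z - g c‖ + ‖g c‖ := by
      simpa using norm_add_le (g z - g c) (g c)
    linarith
  have hz' := hsub hz
  have hch : ‖Complex.cosh (g z)‖ ≤ Real.exp (2 * A + 391) := by
    rw [Complex.cosh, norm_div]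
    have h1 := (Complex.norm_exp_le_exp_norm (g z)).trans (Real.exp_le_exp.2 hgz)
    have h2 : ‖Complex.exp (-g z)‖ ≤ Real.exp (2 * A + 391) :=
      (Complex.norm_exp_le_exp_norm (-g z)).trans
        (Real.exp_le_exp.2 ((norm_neg (g z)).le.trans hgz))
    have h3 := norm_add_le (Complex.exp (g z)) (Complex.exp (-g z))
    have h4 : ‖(2:ℂ)‖ = 2 := by simp
    rw [h4]; linarith
  rw [← hL z hz']
  refine (Complex.norm_exp_le_exp_norm _).trans (Real.exp_le_exp.2 ?_)
  rw [hFL, norm_mul, hnpiI, ← hcosh z hz', norm_pow, mul_comm]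
  gcongr

theorem aux_little_picard {f : ℂ → ℂ} (hf : Differentiable ℂ f)
    (h01 : ∀ z, f z ≠ 0 ∧ f z ≠ 1) (z w : ℂ) : f z = f w := by
  obtain ⟨C, hC⟩ := aux_schottky ‖Complex.log (f 0)‖
  refine hf.apply_eq_apply_of_bounded ?_ z w
  rw [isBounded_iff_forall_norm_le]
  refine ⟨C, ?_⟩
  rintro _ ⟨y, rfl⟩
  refine hC f 0 (2 * (‖y‖ + 1)) (by positivity) hf.differentiableOn (fun z _ => h01 z) le_rfl y ?_
  rw [mem_ball_zero_iff]; linarith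

theorem aux_circle {h : ℂ → ℂ} {C A : ℝ}
    (hC : ∀ (f : ℂ → ℂ) (c : ℂ) (R : ℝ), 0 < R →
    DifferentiableOn ℂ f (Metric.ball c R) →
    (∀ z ∈ Metric.ball c R, f z ≠ 0 ∧ f z ≠ 1) → ‖Complex.log (f c)‖ ≤ A →
    ∀ z ∈ Metric.ball c (R/2), ‖f z‖ ≤ C)
    (hd : DifferentiableOn ℂ h ({0, 1} : Set ℂ)ᶜ)
    (hm : MapsTo h ({0, 1} : Set ℂ)ᶜ ({0, 1} : Set ℂ)ᶜ)
    {z : ℂ} (hz0 : z ≠ 0) (hz : ‖z‖ < Real.exp (-20)) (hA : ‖Complex.log (h z)‖ ≤ A)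
    {y : ℂ} (hy : ‖y‖ = ‖z‖) : ‖h y‖ ≤ C := by
  have hy0 : y ≠ 0 := by
    rw [← norm_pos_iff, hy]; exact norm_pos_iff.2 hz0
  have hre : (Complex.log z).re < -20 := by
    rw [Complex.log_re, Real.log_lt_iff_lt_exp (norm_pos_iff.2 hz0)]; exact hz
  have hmem : ∀ x ∈ Metric.ball (Complex.log z) 20, Complex.exp x ∈ ({0, 1} : Set ℂ)ᶜ := by
    intro x hx
    have h1 : |(x - Complex.log z).re| < 20 := by
      refine (Complex.abs_re_le_norm _).trans_lt ?_
      rw [← dist_eq_norm]; exact hx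
    rw [Complex.sub_re, abs_lt] at h1
    have h2 : ‖Complex.exp x‖ < 1 := by
      rw [Complex.norm_exp, Real.exp_lt_one_iff]; linarith [h1.2]
    simp only [mem_compl_iff, mem_insert_iff, mem_singleton_iff, not_or]
    refine ⟨Complex.exp_ne_zero x, fun h => ?_⟩
    rw [h] at h2; simp at h2
  have := hC (fun x => h (Complex.exp x)) (Complex.log z) 20 (by norm_num)
    (hd.comp Complex.differentiable_exp.differentiableOn hmem)
    (fun x hx => by simpa using hm (hmem x hx)) (by simpa [Complex.exp_log hz0] using hA)
    (Complex.log z + (y.arg - z.arg : ℝ) * Complex.I)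
  have e : Complex.exp (Complex.log z + (y.arg - z.arg : ℝ) * Complex.I) = y := by
    conv_rhs => rw [← Complex.exp_log hy0]
    congr 1
    apply Complex.ext <;> simp [Complex.log_re, Complex.log_im, hy]
  simp only [e] at this
  apply this
  rw [Metric.mem_ball, dist_eq_norm, add_sub_cancel_left, norm_mul, Complex.norm_I, mul_one,
    Complex.norm_real, Real.norm_eq_abs]
  have h1 := Complex.abs_arg_le_pi y
  have h2 := Complex.abs_arg_le_pi z
  have h3 := abs_sub y.arg z.arg
  linarith [Real.pi_lt_d2]

theorem aux_core (h : ℂ → ℂ)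
    (hd : DifferentiableOn ℂ h ({0, 1} : Set ℂ)ᶜ)
    (hm : MapsTo h ({0, 1} : Set ℂ)ᶜ ({0, 1} : Set ℂ)ᶜ)
    (K : Set ℂ) (hK : K ⊆ ({0, 1} : Set ℂ)ᶜ) (hKc : IsCompact K)
    (h0 : (0 : ℂ) ∈ closure (({0, 1} : Set ℂ)ᶜ ∩ h ⁻¹' K)) :
    ∃ c : ℂ, ∀ z ∈ ({0, 1} : Set ℂ)ᶜ, h z = c := by
  have hXo : IsOpen (({0, 1} : Set ℂ)ᶜ) := (Set.toFinite _).isClosed.isOpen_compl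
  have hX : ∀ z : ℂ, z ∈ ({0, 1} : Set ℂ)ᶜ ↔ z ≠ 0 ∧ z ≠ 1 := fun z => by simp
  -- bounds on K
  obtain ⟨B1, hB1⟩ := hKc.isBounded.exists_norm_le
  have hKi : IsCompact ((fun z : ℂ => z⁻¹) '' K) :=
    hKc.image_of_continuousOn (continuousOn_inv₀.mono fun z hz => ((hX z).1 (hK hz)).1)
  obtain ⟨B2, hB2⟩ := hKi.isBounded.exists_norm_le
  have hKlog : ∀ z ∈ K, ‖Complex.log z‖ ≤ max B1 B2 + 4 := fun z hz =>
    aux_log_norm ((hX z).1 (hK hz)).1 ((hB1 z hz).trans (le_max_left _ _))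
      ((hB2 _ ⟨z, hz, rfl⟩).trans (le_max_right _ _))
  obtain ⟨C, hC⟩ := aux_schottky (max B1 B2 + 4)
  have hcirc : ∀ z ∈ (({0, 1} : Set ℂ)ᶜ ∩ h ⁻¹' K), ‖z‖ < Real.exp (-20) →
      ∀ y : ℂ, ‖y‖ = ‖z‖ → ‖h y‖ ≤ C := fun z hz hze y hy =>
    aux_circle hC hd hm ((hX z).1 hz.1).1 hze (hKlog _ hz.2) hy
  have hsm : ∀ ε > 0, ∃ z ∈ (({0, 1} : Set ℂ)ᶜ ∩ h ⁻¹' K), ‖z‖ < ε := by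
    intro ε hε
    obtain ⟨z, hz, hz2⟩ := Metric.mem_closure_iff.1 h0 ε hε
    exact ⟨z, hz, by simpa using hz2⟩
  obtain ⟨z1, hz1, hz1n⟩ := hsm _ (Real.exp_pos (-20))
  have he1 : Real.exp (-20) < 1 := by rw [Real.exp_lt_one_iff]; norm_num
  have hz10 : 0 < ‖z1‖ := norm_pos_iff.2 ((hX z1).1 hz1.1).1
  have hbd : ∀ y : ℂ, y ≠ 0 → ‖y‖ < ‖z1‖ → ‖h y‖ ≤ C := by
    intro y hy0 hy
    have hyp : 0 < ‖y‖ := norm_pos_iff.2 hy0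
    obtain ⟨z2, hz2, hz2n⟩ := hsm _ hyp
    have hz20 : 0 < ‖z2‖ := norm_pos_iff.2 ((hX z2).1 hz2.1).1
    set U : Set ℂ := {x | ‖z2‖ < ‖x‖ ∧ ‖x‖ < ‖z1‖} with hU
    have hUo : IsOpen U := (isOpen_lt continuous_const continuous_norm).inter
      (isOpen_lt continuous_norm continuous_const)
    have hcl : closure U ⊆ {x | ‖z2‖ ≤ ‖x‖ ∧ ‖x‖ ≤ ‖z1‖} := by
      apply closure_minimal
      · exact fun x hx => ⟨hx.1.le, hx.2.le⟩
      · exact (isClosed_le continuous_const continuous_norm).inter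
          (isClosed_le continuous_norm continuous_const)
    have hclX : closure U ⊆ ({0, 1} : Set ℂ)ᶜ := by
      intro x hx
      obtain ⟨ha, hb⟩ := hcl hx
      rw [hX]
      constructor
      · rintro rfl; rw [norm_zero] at ha; linarith
      · rintro rfl; rw [norm_one] at hb; linarith
    refine Complex.norm_le_of_forall_mem_frontier_norm_le (U := U) ?_ ?_ ?_
      (subset_closure ⟨hz2n, hy⟩)
    · rw [isBounded_iff_forall_norm_le]
      exact ⟨‖z1‖, fun x hx => hx.2.le⟩
    · exact ⟨hd.mono (subset_closure.trans hclX), hd.continuousOn.mono hclX⟩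
    · intro x hx
      rw [hUo.frontier_eq] at hx
      obtain ⟨ha, hb⟩ := hcl hx.1
      rcases ha.eq_or_lt with ha | ha
      · exact hcirc z2 hz2 (hz2n.trans (hy.trans hz1n)) x ha.symm
      · rcases hb.eq_or_lt with hb | hb
        · exact hcirc z1 hz1 hz1n x hb
        · exact absurd ⟨ha, hb⟩ hx.2
  -- removable singularity
  have hball : Metric.ball (0:ℂ) ‖z1‖ \ {0} ⊆ ({0, 1} : Set ℂ)ᶜ := by
    rintro x ⟨hx, hx0⟩
    rw [mem_ball_zero_iff] at hx
    refine (hX x).2 ⟨hx0, ?_⟩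
    rintro rfl; rw [norm_one] at hx; linarith
  have hnb : Metric.ball (0:ℂ) ‖z1‖ ∈ nhds 0 := Metric.ball_mem_nhds 0 hz10
  obtain ⟨ℓ, hrem⟩ : ∃ ℓ : ℂ,
      DifferentiableOn ℂ (Function.update h 0 ℓ) (Metric.ball (0:ℂ) ‖z1‖) := by
    refine ⟨_, Complex.differentiableOn_update_limUnder_of_bddAbove hnb (hd.mono hball) ⟨C, ?_⟩⟩
    rintro _ ⟨x, ⟨hx, hx0⟩, rfl⟩
    exact hbd x hx0 (mem_ball_zero_iff.1 hx)
  set H := Function.update h 0 ℓ with hH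
  have hHh : ∀ z, z ≠ 0 → H z = h z := fun z hz => Function.update_of_ne hz _ _
  have hH0 : H 0 ∈ K := by
    have hcont : ContinuousAt H 0 := (hrem.differentiableAt hnb).continuousAt
    have h1 := hcont.continuousWithinAt.mem_closure_image h0
    rw [← hKc.isClosed.closure_eq]
    refine closure_mono ?_ h1
    rintro _ ⟨x, hx, rfl⟩
    rw [hHh x ((hX x).1 hx.1).1]; exact hx.2
  have hHd : ∀ z, z ≠ 1 → DifferentiableAt ℂ H z := by
    intro z hz
    by_cases hz0 : z = 0
    · rw [hz0]; exact hrem.differentiableAt hnb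
    · have h1 : DifferentiableAt ℂ h z := hd.differentiableAt (hXo.mem_nhds ((hX z).2 ⟨hz0, hz⟩))
      refine h1.congr_of_eventuallyEq ?_
      filter_upwards [isOpen_ne.mem_nhds hz0] with x hx using hHh x hx
  have hH01 : ∀ z, z ≠ 1 → H z ≠ 0 ∧ H z ≠ 1 := by
    intro z hz
    by_cases hz0 : z = 0
    · rw [hz0]; exact (hX _).1 (hK hH0)
    · rw [hHh z hz0]; exact (hX _).1 (hm ((hX z).2 ⟨hz0, hz⟩))
  have hne : ∀ x : ℂ, 1 + Complex.exp x ≠ 1 := fun x => by simp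
  have hent : Differentiable ℂ (fun x => H (1 + Complex.exp x)) := by
    intro x
    exact (hHd _ (hne x)).comp x (Complex.differentiable_exp.differentiableAt.const_add 1)
  have hconst := aux_little_picard hent (fun x => hH01 _ (hne x))
  refine ⟨H (1 + Complex.exp 0), fun z hz => ?_⟩
  obtain ⟨hz0, hz1'⟩ := (hX z).1 hz
  have := hconst (Complex.log (z - 1)) 0
  rw [Complex.exp_log (sub_ne_zero.2 hz1')] at this
  rw [← this, ← hHh z hz0]; congr 1; ring

/-- A holomorphic self-map of `ℂ ∖ {0,1}` which is not proper (some compact subset of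
`ℂ ∖ {0,1}` has non-compact preimage) is constant. -/
theorem nonproper_holo_selfmap_is_constant (h : ℂ → ℂ)
    (hd : DifferentiableOn ℂ h ({0, 1} : Set ℂ)ᶜ)
    (hm : MapsTo h ({0, 1} : Set ℂ)ᶜ ({0, 1} : Set ℂ)ᶜ)
    (hnp : ∃ K, K ⊆ ({0, 1} : Set ℂ)ᶜ ∧ IsCompact K ∧
      ¬ IsCompact (({0, 1} : Set ℂ)ᶜ ∩ h ⁻¹' K)) :
    ∃ c : ℂ, ∀ z ∈ ({0, 1} : Set ℂ)ᶜ, h z = c := by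
  obtain ⟨K, hK, hKc, hS⟩ := hnp
  have hX : ∀ z : ℂ, z ∈ ({0, 1} : Set ℂ)ᶜ ↔ z ≠ 0 ∧ z ≠ 1 := fun z => by simp
  have hXo : IsOpen (({0, 1} : Set ℂ)ᶜ) := (Set.toFinite _).isClosed.isOpen_compl
  set S := ({0, 1} : Set ℂ)ᶜ ∩ h ⁻¹' K with hSdef
  by_cases h0 : (0:ℂ) ∈ closure S
  · exact aux_core h hd hm K hK hKc h0
  by_cases h1 : (1:ℂ) ∈ closure S
  · have hmp : MapsTo (fun z : ℂ => 1 - z) ({0, 1} : Set ℂ)ᶜ ({0, 1} : Set ℂ)ᶜ := by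
      intro z hz
      rw [hX] at hz ⊢
      exact ⟨sub_ne_zero.2 hz.2.symm, fun e => hz.1 (by linear_combination -e)⟩
    obtain ⟨c, hc⟩ := aux_core (fun z => h (1 - z)) (hd.comp (by fun_prop) hmp) (hm.comp hmp)
      K hK hKc (by
        have hcw : ContinuousWithinAt (fun z : ℂ => 1 - z) S 1 := by fun_prop
        have h2 := hcw.mem_closure_image h1
        rw [sub_self] at h2
        refine closure_mono ?_ h2
        rintro _ ⟨x, hx, rfl⟩
        exact ⟨hmp hx.1, by simpa using hx.2⟩)
    refine ⟨c, fun z hz => ?_⟩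
    simpa using hc (1 - z) (hmp hz)
  have hcl : IsClosed S := by
    rw [← closure_subset_iff_isClosed]
    intro q hq
    have hqX : q ∈ ({0, 1} : Set ℂ)ᶜ := by
      rw [hX]
      exact ⟨fun e => h0 (e ▸ hq), fun e => h1 (e ▸ hq)⟩
    refine ⟨hqX, ?_⟩
    have hcont : ContinuousAt h q := (hd.differentiableAt (hXo.mem_nhds hqX)).continuousAt
    have h2 := hcont.continuousWithinAt.mem_closure_image hq
    have h3 : h q ∈ closure K := closure_mono (by rintro _ ⟨x, hx, rfl⟩; exact hx.2) h2
    rwa [hKc.isClosed.closure_eq] at h3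
  have hub : ¬ Bornology.IsBounded S := fun hb => hS (Metric.isCompact_of_isClosed_isBounded hcl hb)
  have hmp : MapsTo (fun z : ℂ => z⁻¹) ({0, 1} : Set ℂ)ᶜ ({0, 1} : Set ℂ)ᶜ := by
    intro z hz
    rw [hX] at hz ⊢
    exact ⟨inv_ne_zero hz.1, fun e => hz.2 (inv_eq_one.1 e)⟩
  obtain ⟨c, hc⟩ := aux_core (fun z => h z⁻¹)
    (hd.comp (differentiableOn_inv.mono fun z hz => ((hX z).1 hz).1) hmp) (hm.comp hmp)
    K hK hKc (by
      rw [Metric.mem_closure_iff]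
      intro ε hε
      rw [isBounded_iff_forall_norm_le] at hub
      push Not at hub
      obtain ⟨x, hx, hxn⟩ := hub ε⁻¹
      refine ⟨x⁻¹, ⟨hmp hx.1, by simpa using hx.2⟩, ?_⟩
      rw [dist_zero_left, norm_inv]
      exact inv_lt_of_inv_lt₀ hε hxn)
  refine ⟨c, fun z hz => ?_⟩
  simpa using hc z⁻¹ (hmp hz)
end

section
/- Let h : ℂ ∖ {0,1} → ℂ ∖ {0,1} be a proper holomorphic map (the preimage under h of every compact subset of ℂ ∖ {0,1} is compact). Then h is the restriction to ℂ ∖ {0,1} of one of the following six Möbius transformations: z ↦ z, z ↦ 1 − z, z ↦ 1/z, z ↦ 1/(1 − z), z ↦ z/(z − 1), z ↦ (z − 1)/z. -/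
open Set

open Filter Topology Bornology

lemma aux_preconn (p : ℂ) (r : ℝ) (hr : 0 < r) : IsPreconnected (Metric.ball p r \ {p}) := by
  have h1 : IsPreconnected {w : ℂ | w.re < Real.log r} :=
    (convex_halfSpace_re_lt _).isPreconnected
  have h2 : Metric.ball p r \ {p} = (fun w => p + Complex.exp w) '' {w : ℂ | w.re < Real.log r} := by
    ext z
    constructor
    · rintro ⟨hz, hne⟩
      have hne' : z - p ≠ 0 := sub_ne_zero.2 hne
      refine ⟨Complex.log (z - p), ?_, ?_⟩
      · simp only [mem_ofPred_eq, Complex.log_re]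
        exact Real.log_lt_log (norm_pos_iff.2 hne') (by simpa [dist_eq_norm] using hz)
      · simp [Complex.exp_log hne']
    · rintro ⟨w, hw, rfl⟩
      refine ⟨?_, by simp⟩
      simp only [Metric.mem_ball, dist_eq_norm, add_sub_cancel_left, Complex.norm_exp]
      exact (Real.lt_log_iff_exp_lt hr).1 hw
  rw [h2]
  exact h1.image _ (by fun_prop)

/-- the limit of `f` along `L` is one of the three punctures -/
def Tri (f : ℂ → ℂ) (L : Filter ℂ) : Prop :=
  Tendsto f L (𝓝[≠] 0) ∨ Tendsto f L (𝓝[≠] 1) ∨ Tendsto f L (cobounded ℂ)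

def KK (e : ℝ) : Set ℂ := {z | e ≤ ‖z‖ ∧ e ≤ ‖z - 1‖ ∧ ‖z‖ ≤ e⁻¹}

lemma KK_compact (e : ℝ) : IsCompact (KK e) := by
  refine Metric.isCompact_of_isClosed_isBounded ?_ ?_
  · have c0 : IsClosed {z : ℂ | e ≤ ‖z‖} := isClosed_le (by fun_prop) (by fun_prop)
    have c1 : IsClosed {z : ℂ | e ≤ ‖z - 1‖} := isClosed_le (by fun_prop) (by fun_prop)
    have c2 : IsClosed {z : ℂ | ‖z‖ ≤ e⁻¹} := isClosed_le (by fun_prop) (by fun_prop)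
    exact c0.inter (c1.inter c2)
  · refine (Metric.isBounded_closedBall (x := (0:ℂ)) (r := e⁻¹)).subset ?_
    intro z hz
    simpa using hz.2.2

lemma KK_sub {e : ℝ} (he : 0 < e) : KK e ⊆ ({0, 1} : Set ℂ)ᶜ := by
  rintro z ⟨h1, h2, h3⟩ hz
  rcases hz with rfl | hz
  · simp at h1; linarith
  · simp only [mem_singleton_iff] at hz
    subst hz; simp at h2; linarith

lemma tri_of (f : ℂ → ℂ) (p : ℂ) (hc : ∀ᶠ z in 𝓝[≠] p, ContinuousAt f z)
    (hX : ∀ᶠ z in 𝓝[≠] p, f z ≠ 0 ∧ f z ≠ 1)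
    (hK : ∀ K, K ⊆ ({0, 1} : Set ℂ)ᶜ → IsCompact K → ∀ᶠ z in 𝓝[≠] p, f z ∉ K) :
    Tri f (𝓝[≠] p) := by
  have key : ∀ e : ℝ, 0 < e → ∀ᶠ z in 𝓝[≠] p, ‖f z‖ < e ∨ ‖f z - 1‖ < e ∨ e⁻¹ < ‖f z‖ := by
    intro e he
    filter_upwards [hK _ (KK_sub he) (KK_compact e)] with z hz
    by_contra! hcon
    exact hz hcon
  have h0 := (key (1/4) (by norm_num)).and hc
  rw [eventually_nhdsWithin_iff, Metric.eventually_nhds_iff_ball] at h0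
  obtain ⟨r, hr, h0⟩ := h0
  have hU : Metric.ball p r \ {p} ∈ 𝓝[≠] p :=
    sdiff_mem_nhdsWithin_compl (Metric.ball_mem_nhds p hr) _
  have hcon : IsPreconnected (f '' (Metric.ball p r \ {p})) :=
    (aux_preconn p r hr).image _ fun z hz => (h0 z hz.1 hz.2).2.continuousWithinAt
  have o0 : IsOpen {z : ℂ | ‖z‖ < 1/4} := isOpen_lt (by fun_prop) (by fun_prop)
  have o1 : IsOpen {z : ℂ | ‖z - 1‖ < 1/4} := isOpen_lt (by fun_prop) (by fun_prop)
  have o2 : IsOpen {z : ℂ | 4 < ‖z‖} := isOpen_lt (by fun_prop) (by fun_prop)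
  have tri1 : ∀ z : ℂ, 1 ≤ ‖z‖ + ‖z - 1‖ := by
    intro z
    have := norm_sub_le z (z - 1)
    simpa using this
  have tri2 : ∀ z : ℂ, ‖z‖ ≤ ‖z - 1‖ + 1 := by
    intro z
    have := norm_add_le (z - 1) 1
    simpa using this
  have d0 : Disjoint {z : ℂ | ‖z‖ < 1/4} ({z : ℂ | ‖z - 1‖ < 1/4} ∪ {z : ℂ | 4 < ‖z‖}) := by
    rw [Set.disjoint_left]
    rintro z hz (h | h) <;> simp only [mem_ofPred_eq] at hz h <;> linarith [tri1 z]
  have d1 : Disjoint {z : ℂ | ‖z - 1‖ < 1/4} {z : ℂ | 4 < ‖z‖} := by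
    rw [Set.disjoint_left]
    intro z hz h
    simp only [mem_ofPred_eq] at hz h
    linarith [tri2 z]
  have hcov : f '' (Metric.ball p r \ {p}) ⊆
      {z : ℂ | ‖z‖ < 1/4} ∪ ({z : ℂ | ‖z - 1‖ < 1/4} ∪ {z : ℂ | 4 < ‖z‖}) := by
    rintro _ ⟨z, hz, rfl⟩
    have := (h0 z hz.1 hz.2).1
    norm_num at this ⊢
    exact this
  rcases hcon.subset_or_subset o0 (o1.union o2) d0 hcov with hA | hA
  · left
    rw [tendsto_nhdsWithin_iff]
    refine ⟨?_, hX.mono fun z hz => hz.1⟩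
    rw [Metric.tendsto_nhds]
    intro e he
    filter_upwards [hU, key (min e (1/4)) (by positivity)] with z hz hk
    have h1 : ‖f z‖ < 1/4 := hA ⟨z, hz, rfl⟩
    have h2 : (4:ℝ) ≤ (min e (1/4))⁻¹ := by
      rw [le_inv_comm₀ (by norm_num) (by positivity)]
      exact (min_le_right _ _).trans (by norm_num)
    have h3 := min_le_left e (1/4)
    have h4 := min_le_right e (1/4)
    rw [dist_zero_right]
    rcases hk with hk | hk | hk
    · linarith
    · linarith [tri1 (f z)]
    · linarith
  right
  rcases hcon.subset_or_subset o1 o2 d1 hA with hA | hA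
  · left
    rw [tendsto_nhdsWithin_iff]
    refine ⟨?_, hX.mono fun z hz => hz.2⟩
    rw [Metric.tendsto_nhds]
    intro e he
    filter_upwards [hU, key (min e (1/4)) (by positivity)] with z hz hk
    have h1 : ‖f z - 1‖ < 1/4 := hA ⟨z, hz, rfl⟩
    have h2 : (4:ℝ) ≤ (min e (1/4))⁻¹ := by
      rw [le_inv_comm₀ (by norm_num) (by positivity)]
      exact (min_le_right _ _).trans (by norm_num)
    have h3 := min_le_left e (1/4)
    have h4 := min_le_right e (1/4)
    rw [dist_eq_norm]
    rcases hk with hk | hk | hk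
    · linarith [tri1 (f z)]
    · linarith
    · linarith [tri2 (f z)]
  · right
    rw [← tendsto_norm_atTop_iff_cobounded, tendsto_atTop]
    intro b
    have hbp : 0 < max b 4 := lt_max_of_lt_right (by norm_num)
    filter_upwards [hU, key (max b 4)⁻¹ (by positivity)] with z hz hk
    have h1 : 4 < ‖f z‖ := hA ⟨z, hz, rfl⟩
    have h2 : (max b 4)⁻¹ ≤ 1/4 := by
      rw [inv_le_comm₀ hbp (by norm_num)]
      norm_num
    have h3 := le_max_left b 4
    rw [inv_inv] at hk
    rcases hk with hk | hk | hk
    · linarith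
    · linarith [tri2 (f z)]
    · linarith

lemma t_inv_one : Tendsto (fun z : ℂ => z⁻¹) (𝓝[≠] 1) (𝓝[≠] 1) := by
  rw [tendsto_nhdsWithin_iff]
  refine ⟨?_, ?_⟩
  · have := tendsto_inv₀ (one_ne_zero : (1:ℂ) ≠ 0)
    rw [inv_one] at this
    exact this.mono_left nhdsWithin_le_nhds
  · filter_upwards [self_mem_nhdsWithin] with z hz
    simpa using hz

lemma t_sub_zero : Tendsto (fun z : ℂ => 1 - z) (𝓝[≠] 0) (𝓝[≠] 1) := by
  rw [tendsto_nhdsWithin_iff]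
  refine ⟨?_, ?_⟩
  · have : Tendsto (fun z : ℂ => 1 - z) (𝓝 0) (𝓝 (1 - 0)) := Continuous.tendsto (by fun_prop) 0
    rw [sub_zero] at this
    exact this.mono_left nhdsWithin_le_nhds
  · filter_upwards [self_mem_nhdsWithin] with z hz
    simpa using hz

lemma t_sub_one : Tendsto (fun z : ℂ => 1 - z) (𝓝[≠] 1) (𝓝[≠] 0) := by
  rw [tendsto_nhdsWithin_iff]
  refine ⟨?_, ?_⟩
  · have : Tendsto (fun z : ℂ => 1 - z) (𝓝 1) (𝓝 (1 - 1)) := Continuous.tendsto (by fun_prop) 1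
    rw [sub_self] at this
    exact this.mono_left nhdsWithin_le_nhds
  · filter_upwards [self_mem_nhdsWithin] with z hz
    exact sub_ne_zero.2 (Ne.symm hz)

lemma t_sub_inf : Tendsto (fun z : ℂ => 1 - z) (cobounded ℂ) (cobounded ℂ) := by
  rw [← tendsto_norm_atTop_iff_cobounded]
  refine tendsto_atTop_mono (f := fun z : ℂ => ‖z‖ - 1) ?_
    (tendsto_atTop_add_const_right _ (-1) tendsto_norm_cobounded_atTop)
  intro z
  have := norm_sub_norm_le z 1
  rw [norm_sub_rev] at this
  simpa using this

lemma Tri.inv {f : ℂ → ℂ} {L : Filter ℂ} (h : Tri f L) : Tri (fun z => (f z)⁻¹) L := by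
  rcases h with h | h | h
  · exact Or.inr (Or.inr (tendsto_inv₀_nhdsNE_zero.comp h))
  · exact Or.inr (Or.inl (t_inv_one.comp h))
  · exact Or.inl (tendsto_inv₀_cobounded'.comp h)

lemma Tri.sub {f : ℂ → ℂ} {L : Filter ℂ} (h : Tri f L) : Tri (fun z => 1 - f z) L := by
  rcases h with h | h | h
  · exact Or.inr (Or.inl (t_sub_zero.comp h))
  · exact Or.inl (t_sub_one.comp h)
  · exact Or.inr (Or.inr (t_sub_inf.comp h))

lemma diff_of_punct {g : ℂ → ℂ} {p : ℂ} (hg : ∀ z, z ≠ p → DifferentiableAt ℂ g z)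
    (hc : Tendsto g (𝓝[≠] p) (𝓝 (g p))) : Differentiable ℂ g := by
  rw [← differentiableOn_univ,
    ← Complex.differentiableOn_compl_singleton_and_continuousAt_iff (c := p) univ_mem]
  refine ⟨fun z hz => (hg z hz.2).differentiableWithinAt, ?_⟩
  exact continuousAt_iff_punctured_nhds.2 hc

lemma ext_one {h : ℂ → ℂ} {S : Set ℂ} (p a : ℂ) (hS : IsOpen S)
    (hd : DifferentiableOn ℂ h (S \ {p})) (hp : p ∈ S) (ha : Tendsto h (𝓝[≠] p) (𝓝 a)) :
    DifferentiableOn ℂ (Function.update h p a) S := by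
  rw [← Complex.differentiableOn_compl_singleton_and_continuousAt_iff (hS.mem_nhds hp)]
  refine ⟨hd.congr fun z hz => Function.update_of_ne hz.2 _ _, ?_⟩
  exact continuousAt_update_same.2 ha

lemma extend {h : ℂ → ℂ} (hd : DifferentiableOn ℂ h ({0, 1} : Set ℂ)ᶜ) {a b : ℂ}
    (h0 : Tendsto h (𝓝[≠] 0) (𝓝 a)) (h1 : Tendsto h (𝓝[≠] 1) (𝓝 b)) :
    ∃ g : ℂ → ℂ, Differentiable ℂ g ∧ g 0 = a ∧ g 1 = b ∧ ∀ z, z ≠ 0 → z ≠ 1 → g z = h z := by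
  refine ⟨Function.update (Function.update h 0 a) 1 b, ?_, ?_, ?_, ?_⟩
  · rw [← differentiableOn_univ]
    refine ext_one 1 b isOpen_univ ?_ (mem_univ _) ?_
    · refine ext_one 0 a (isOpen_univ.sdiff isClosed_singleton) (hd.mono ?_) (by simp) h0
      rintro z ⟨⟨_, h1⟩, h2⟩
      simp_all
    · refine h1.congr' ?_
      have : ∀ᶠ z : ℂ in 𝓝[≠] 1, z ≠ 0 :=
        (eventually_ne_nhds one_ne_zero).filter_mono nhdsWithin_le_nhds
      filter_upwards [this] with z hz
      rw [Function.update_of_ne hz]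
  · simp
  · simp
  · intro z h0 h1
    simp [h0, h1]

lemma mem_X {z : ℂ} : z ∈ ({0, 1} : Set ℂ)ᶜ ↔ z ≠ 0 ∧ z ≠ 1 := by simp

lemma evne_inf (a : ℂ) : ∀ᶠ z in cobounded ℂ, z ≠ a :=
  isBounded_def.1 (isBounded_singleton (x := a))

lemma no_inf {h : ℂ → ℂ} (hd : DifferentiableOn ℂ h ({0, 1} : Set ℂ)ᶜ)
    (hm : MapsTo h ({0, 1} : Set ℂ)ᶜ ({0, 1} : Set ℂ)ᶜ)
    (T0 : Tri h (𝓝[≠] 0)) (T1 : Tri h (𝓝[≠] 1)) (Ti : Tri h (cobounded ℂ)) :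
    Tendsto h (𝓝[≠] 0) (cobounded ℂ) ∨ Tendsto h (𝓝[≠] 1) (cobounded ℂ) ∨
    Tendsto h (cobounded ℂ) (cobounded ℂ) := by
  by_contra! hcon
  have red : ∀ L, Tri h L → ¬ Tendsto h L (cobounded ℂ) →
      ∃ a : ℂ, (a = 0 ∨ a = 1) ∧ Tendsto h L (𝓝 a) := by
    rintro L (h | h | h) hn
    · exact ⟨0, Or.inl rfl, h.mono_right nhdsWithin_le_nhds⟩
    · exact ⟨1, Or.inr rfl, h.mono_right nhdsWithin_le_nhds⟩
    · exact absurd h hn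
  obtain ⟨a, -, h0⟩ := red _ T0 hcon.1
  obtain ⟨b, -, h1⟩ := red _ T1 hcon.2.1
  obtain ⟨c, hc, hi⟩ := red _ Ti hcon.2.2
  obtain ⟨g, hg, -, -, hgh⟩ := extend hd h0 h1
  have hgi : Tendsto g (cobounded ℂ) (𝓝 c) := by
    refine hi.congr' ?_
    filter_upwards [evne_inf 0, evne_inf 1] with z h0 h1
    exact (hgh z h0 h1).symm
  rw [Metric.cobounded_eq_cocompact] at hgi
  have h2 := hg.apply_eq_of_tendsto_cocompact 2 hgi
  rw [hgh 2 (by norm_num) (by norm_num)] at h2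
  have := mem_X.1 (hm (mem_X.2 ⟨two_ne_zero, by norm_num⟩ : (2:ℂ) ∈ _))
  rw [h2] at this
  tauto

lemma core {h : ℂ → ℂ} (hd : DifferentiableOn ℂ h ({0, 1} : Set ℂ)ᶜ)
    (hm : MapsTo h ({0, 1} : Set ℂ)ᶜ ({0, 1} : Set ℂ)ᶜ)
    (T0 : Tendsto h (𝓝[≠] 0) (𝓝[≠] 0)) (T1 : Tendsto h (𝓝[≠] 1) (𝓝[≠] 1))
    (Ti : Tendsto h (cobounded ℂ) (cobounded ℂ)) :
    ∀ z ∈ ({0, 1} : Set ℂ)ᶜ, h z = z := by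
  obtain ⟨g, hg, g0, g1, hgh⟩ := extend hd (T0.mono_right nhdsWithin_le_nhds)
    (T1.mono_right nhdsWithin_le_nhds)
  have gne0 : ∀ z, z ≠ 0 → g z ≠ 0 := by
    intro z hz
    by_cases h1 : z = 1
    · rw [h1, g1]; exact one_ne_zero
    · rw [hgh z hz h1]; exact (mem_X.1 (hm (mem_X.2 ⟨hz, h1⟩))).1
  have gne1 : ∀ z, z ≠ 1 → g z ≠ 1 := by
    intro z hz
    by_cases h1 : z = 0
    · rw [h1, g0]; exact zero_ne_one
    · rw [hgh z h1 hz]; exact (mem_X.1 (hm (mem_X.2 ⟨h1, hz⟩))).2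
  have gi : Tendsto g (cobounded ℂ) (cobounded ℂ) := by
    refine Ti.congr' ?_
    filter_upwards [evne_inf 0, evne_inf 1] with z h0 h1
    exact (hgh z h0 h1).symm
  -- factor near zero
  have fac : ∀ φ : ℂ → ℂ, Differentiable ℂ φ → (∀ z, z ≠ 0 → φ z ≠ 0) →
      ∃ n : ℕ, ∃ k : ℂ → ℂ, ContinuousAt k 0 ∧ k 0 ≠ 0 ∧
        ∀ᶠ z in 𝓝[≠] 0, φ z = z ^ n * k z := by
    intro φ hφ hne
    have han : AnalyticAt ℂ φ 0 := hφ.analyticAt 0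
    have hnz : ¬ ∀ᶠ z in 𝓝 (0:ℂ), φ z = 0 := by
      intro hz
      have h1 : ∀ᶠ z in 𝓝[≠] (0:ℂ), φ z = 0 := hz.filter_mono nhdsWithin_le_nhds
      obtain ⟨z, hz1, hz2⟩ := (h1.and self_mem_nhdsWithin).exists
      exact hne z hz2 hz1
    obtain ⟨n, k, hk, hk0, he⟩ := han.exists_eventuallyEq_pow_smul_nonzero_iff.2 hnz
    refine ⟨n, k, hk.continuousAt, hk0, ?_⟩
    refine (he.filter_mono nhdsWithin_le_nhds).mono fun z hz => ?_
    simpa using hz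
  obtain ⟨n, k, hk, hk0, hgk⟩ := fac g hg gne0
  set φ : ℂ → ℂ := fun w => (g w⁻¹)⁻¹ with hφdef
  have hφ : Differentiable ℂ φ := by
    refine diff_of_punct (p := 0) ?_ ?_
    · intro z hz
      exact (DifferentiableAt.comp z (hg _) (differentiableAt_inv hz)).inv (gne0 _ (inv_ne_zero hz))
    · have : φ 0 = 0 := by simp [hφdef, g0]
      rw [this]
      exact tendsto_inv₀_cobounded.comp (gi.comp tendsto_inv₀_nhdsNE_zero)
  have hφne : ∀ z, z ≠ 0 → φ z ≠ 0 := fun z hz => inv_ne_zero (gne0 _ (inv_ne_zero hz))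
  obtain ⟨m, ψ, hψ, hψ0, hφψ⟩ := fac φ hφ hφne
  set G : ℂ → ℂ := Function.update (fun z => g z / z ^ n) 0 (k 0) with hGdef
  have hG : Differentiable ℂ G := by
    rw [← differentiableOn_univ]
    refine ext_one 0 (k 0) isOpen_univ ?_ (mem_univ _) ?_
    · intro z hz
      have hd2 : DifferentiableAt ℂ (fun z : ℂ => z ^ n) z := by fun_prop
      exact ((hg z).div hd2 (pow_ne_zero n hz.2)).differentiableWithinAt
    · have : Tendsto k (𝓝[≠] 0) (𝓝 (k 0)) := hk.tendsto.mono_left nhdsWithin_le_nhds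
      refine this.congr' ?_
      filter_upwards [hgk, self_mem_nhdsWithin] with z hz hz0
      have : z ≠ 0 := hz0
      rw [hz]
      field_simp
  have hGz : ∀ z, z ≠ 0 → G z = g z / z ^ n := fun z hz => Function.update_of_ne hz _ _
  have hGne : ∀ z, G z ≠ 0 := by
    intro z
    by_cases hz : z = 0
    · rw [hz, hGdef]; simpa using hk0
    · rw [hGz z hz]; exact div_ne_zero (gne0 z hz) (pow_ne_zero _ hz)
  have hψi : Tendsto (fun z : ℂ => ψ z⁻¹) (cobounded ℂ) (𝓝 (ψ 0)) :=
    hψ.tendsto.comp tendsto_inv₀_cobounded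
  have hev := tendsto_inv₀_cobounded'.eventually hφψ
  have hconst : ∃ c, ∀ z, G z = c := by
    rcases le_total m n with hmn | hmn
    · have lim : Tendsto G (cobounded ℂ) (𝓝 (0 ^ (n - m) * (ψ 0)⁻¹)) := by
        refine ((tendsto_inv₀_cobounded.pow (n - m)).mul (hψi.inv₀ hψ0)).congr' ?_
        filter_upwards [hev, evne_inf 0] with z hz hz0
        simp only [hφdef, inv_inv] at hz
        rw [hGz z hz0]
        have hgz : g z = (z⁻¹ ^ m * ψ z⁻¹)⁻¹ := by rw [← hz, inv_inv]
        obtain ⟨d, rfl⟩ := Nat.exists_eq_add_of_le hmn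
        rw [hgz, Nat.add_sub_cancel_left, mul_inv, ← inv_pow, inv_inv, pow_add, inv_pow]
        field_simp
      rw [Metric.cobounded_eq_cocompact] at lim
      exact ⟨_, fun z => hG.apply_eq_of_tendsto_cocompact z lim⟩
    · have lim : Tendsto (fun z => (G z)⁻¹) (cobounded ℂ) (𝓝 (0 ^ (m - n) * (ψ 0))) := by
        refine ((tendsto_inv₀_cobounded.pow (m - n)).mul hψi).congr' ?_
        filter_upwards [hev, evne_inf 0] with z hz hz0
        simp only [hφdef, inv_inv] at hz
        rw [hGz z hz0, inv_div, div_eq_mul_inv, hz]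
        obtain ⟨d, rfl⟩ := Nat.exists_eq_add_of_le hmn
        rw [Nat.add_sub_cancel_left, pow_add, inv_pow, inv_pow]
        field_simp
      rw [Metric.cobounded_eq_cocompact] at lim
      refine ⟨(0 ^ (m - n) * (ψ 0))⁻¹, fun z => ?_⟩
      rw [← (hG.inv hGne).apply_eq_of_tendsto_cocompact z lim]
      exact (inv_inv (G z)).symm
  obtain ⟨c, hc⟩ := hconst
  have hgz : ∀ z, z ≠ 0 → g z = z ^ n := by
    have h1 := hGz 1 one_ne_zero
    rw [hc, g1] at h1
    intro z hz
    have h2 := hGz z hz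
    rw [hc, h1] at h2
    have := pow_ne_zero n hz
    field_simp at h2
    simpa using h2.symm
  have hn0 : n ≠ 0 := by
    rintro rfl
    have := hgz 2 two_ne_zero
    rw [pow_zero] at this
    exact gne1 2 (by norm_num) this
  have hprim := Complex.isPrimitiveRoot_exp n hn0
  have hn1 : n = 1 := by
    by_contra hn
    have h1 := hprim.ne_one (by omega)
    exact gne1 _ h1 (by rw [hgz _ (Complex.exp_ne_zero _), hprim.pow_eq_one])
  intro z hz
  obtain ⟨hz0, hz1⟩ := mem_X.1 hz
  rw [← hgh z hz0 hz1, hgz z hz0, hn1, pow_one]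

def Good (h : ℂ → ℂ) : Prop := DifferentiableOn ℂ h ({0, 1} : Set ℂ)ᶜ ∧
    MapsTo h ({0, 1} : Set ℂ)ᶜ ({0, 1} : Set ℂ)ᶜ

lemma Good.inv {h : ℂ → ℂ} (H : Good h) : Good (fun z => (h z)⁻¹) := by
  refine ⟨H.1.inv fun z hz => (mem_X.1 (H.2 hz)).1, fun z hz => ?_⟩
  have := mem_X.1 (H.2 hz)
  rw [mem_X]
  simpa using this

lemma Good.sub {h : ℂ → ℂ} (H : Good h) : Good (fun z => 1 - h z) := by
  refine ⟨(differentiableOn_const 1).sub H.1, fun z hz => ?_⟩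
  have := mem_X.1 (H.2 hz)
  rw [mem_X]
  refine ⟨sub_ne_zero.2 this.2.symm, ?_⟩
  simpa using this.1

lemma evne (p a : ℂ) : ∀ᶠ z in 𝓝[≠] p, z ≠ a := by
  by_cases h : p = a
  · subst h; exact self_mem_nhdsWithin
  · exact (eventually_ne_nhds h).filter_mono nhdsWithin_le_nhds

lemma evX (p : ℂ) : ∀ᶠ z in 𝓝[≠] p, z ∈ ({0, 1} : Set ℂ)ᶜ := by
  filter_upwards [evne p 0, evne p 1] with z h0 h1
  exact mem_X.2 ⟨h0, h1⟩

/-- A proper holomorphic self-map of `ℂ ∖ {0,1}` is the restriction of one of the six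
Möbius transformations permuting `{0, 1, ∞}`. -/
theorem proper_holo_selfmap_is_moebius (h : ℂ → ℂ)
    (hd : DifferentiableOn ℂ h ({0, 1} : Set ℂ)ᶜ)
    (hm : MapsTo h ({0, 1} : Set ℂ)ᶜ ({0, 1} : Set ℂ)ᶜ)
    (hp : ∀ K, K ⊆ ({0, 1} : Set ℂ)ᶜ → IsCompact K →
      IsCompact (({0, 1} : Set ℂ)ᶜ ∩ h ⁻¹' K)) :
    (∀ z ∈ ({0, 1} : Set ℂ)ᶜ, h z = z) ∨
    (∀ z ∈ ({0, 1} : Set ℂ)ᶜ, h z = 1 - z) ∨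
    (∀ z ∈ ({0, 1} : Set ℂ)ᶜ, h z = z⁻¹) ∨
    (∀ z ∈ ({0, 1} : Set ℂ)ᶜ, h z = (1 - z)⁻¹) ∨
    (∀ z ∈ ({0, 1} : Set ℂ)ᶜ, h z = z / (z - 1)) ∨
    (∀ z ∈ ({0, 1} : Set ℂ)ᶜ, h z = (z - 1) / z) := by
  have hXo : IsOpen (({0, 1} : Set ℂ)ᶜ) := (Set.toFinite _).isClosed.isOpen_compl
  have hcont : ∀ z ∈ ({0, 1} : Set ℂ)ᶜ, ContinuousAt h z := fun z hz =>
    (hd.differentiableAt (hXo.mem_nhds hz)).continuousAt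
  have Tp : ∀ p : ℂ, p ∈ ({0, 1} : Set ℂ) → Tri h (𝓝[≠] p) := by
    intro p hpX
    refine tri_of h p ((evX p).mono hcont) ((evX p).mono fun z hz => mem_X.1 (hm hz)) ?_
    intro K hK hKc
    have hc := (hp K hK hKc).isClosed.isOpen_compl.mem_nhds
      (show p ∈ (({0, 1} : Set ℂ)ᶜ ∩ h ⁻¹' K)ᶜ from fun hh => hh.1 hpX)
    filter_upwards [evX p, mem_nhdsWithin_of_mem_nhds hc] with z hz hz2 hz3
    exact hz2 ⟨hz, hz3⟩
  have T0 := Tp 0 (by simp)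
  have T1 := Tp 1 (by simp)
  have evXi : ∀ᶠ z in cobounded ℂ, z ∈ ({0, 1} : Set ℂ)ᶜ := by
    filter_upwards [evne_inf 0, evne_inf 1] with z h0 h1
    exact mem_X.2 ⟨h0, h1⟩
  have Ti : Tri h (cobounded ℂ) := by
    have key : Tri (fun z => h z⁻¹) (𝓝[≠] 0) := by
      have ev : ∀ᶠ z : ℂ in 𝓝[≠] 0, z⁻¹ ∈ ({0, 1} : Set ℂ)ᶜ :=
        tendsto_inv₀_nhdsNE_zero.eventually evXi
      refine tri_of _ 0 ?_ (ev.mono fun z hz => mem_X.1 (hm hz)) ?_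
      · filter_upwards [ev, evne 0 0] with z hz hz0
        exact ContinuousAt.comp (f := fun z : ℂ => z⁻¹) (hcont _ hz) (continuousAt_inv₀ hz0)
      · intro K hK hKc
        have hc := isBounded_def.1 (hp K hK hKc).isBounded
        filter_upwards [ev, tendsto_inv₀_nhdsNE_zero hc] with z hz hz2 hz3
        exact hz2 ⟨hz, hz3⟩
    have conv : ∀ M : Filter ℂ, Tendsto (fun z => h z⁻¹) (𝓝[≠] 0) M → Tendsto h (cobounded ℂ) M := by
      intro M hM
      have := hM.comp tendsto_inv₀_cobounded'
      simpa [Function.comp_def] using this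
    rcases key with k | k | k
    · exact Or.inl (conv _ k)
    · exact Or.inr (Or.inl (conv _ k))
    · exact Or.inr (Or.inr (conv _ k))
  have H : Good h := ⟨hd, hm⟩
  have A := no_inf H.1 H.2 T0 T1 Ti
  have B := no_inf H.inv.1 H.inv.2 T0.inv T1.inv Ti.inv
  have C := no_inf H.sub.inv.1 H.sub.inv.2 T0.sub.inv T1.sub.inv Ti.sub.inv
  have cB : ∀ L, Tendsto (fun z => (h z)⁻¹) L (cobounded ℂ) → Tendsto h L (𝓝[≠] 0) := by
    intro L hL
    have := tendsto_inv₀_cobounded'.comp hL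
    simpa [Function.comp_def] using this
  have cC : ∀ L, Tendsto (fun z => (1 - h z)⁻¹) L (cobounded ℂ) → Tendsto h L (𝓝[≠] 1) := by
    intro L hL
    have := t_sub_zero.comp (tendsto_inv₀_cobounded'.comp hL)
    simpa [Function.comp_def] using this
  have B' := B.imp (cB _) (Or.imp (cB _) (cB _))
  have C' := C.imp (cC _) (Or.imp (cC _) (cC _))
  clear B C cB cC T0 T1 Ti Tp
  have D01 : Disjoint (𝓝[≠] (0:ℂ)) (𝓝[≠] 1) :=
    (disjoint_nhds_nhds.2 zero_ne_one).mono nhdsWithin_le_nhds nhdsWithin_le_nhds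
  have Di : ∀ p : ℂ, Disjoint (𝓝[≠] p) (cobounded ℂ) := fun p =>
    (Metric.disjoint_nhds_cobounded p).mono_left nhdsWithin_le_nhds
  have e01 : ∀ L : Filter ℂ, L.NeBot → Tendsto h L (𝓝[≠] 0) → Tendsto h L (𝓝[≠] 1) → False :=
    fun L _ h1 h2 => h1.not_tendsto D01 h2
  have e0i : ∀ L : Filter ℂ, L.NeBot → Tendsto h L (𝓝[≠] 0) → Tendsto h L (cobounded ℂ) → False :=
    fun L _ h1 h2 => h1.not_tendsto (Di 0) h2
  have e1i : ∀ L : Filter ℂ, L.NeBot → Tendsto h L (𝓝[≠] 1) → Tendsto h L (cobounded ℂ) → False :=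
    fun L _ h1 h2 => h1.not_tendsto (Di 1) h2
  have i0 := tendsto_inv₀_nhdsNE_zero (α := ℂ)
  have ii := tendsto_inv₀_cobounded' (α := ℂ)
  rcases A with A | A | A
  · rcases B' with B | B | B
    · exact (e0i _ inferInstance B A).elim
    · rcases C' with C | C | C
      · exact (e1i _ inferInstance C A).elim
      · exact (e01 _ inferInstance B C).elim
      · -- 0 ↦ ∞, 1 ↦ 0, ∞ ↦ 1 :  1 / (1 - h) fixes all three
        have := core H.sub.inv.1 H.sub.inv.2 (ii.comp (t_sub_inf.comp A))
          (t_inv_one.comp (t_sub_zero.comp B)) (i0.comp (t_sub_one.comp C))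
        refine Or.inr (Or.inr (Or.inr (Or.inr (Or.inr fun z hz => ?_))))
        have e : (1 - h z)⁻¹ = z := this z hz
        have hz0 := (mem_X.1 hz).1
        rw [inv_eq_iff_eq_inv] at e
        have : h z = 1 - z⁻¹ := by rw [← e]; ring
        rw [this]; field_simp
    · rcases C' with C | C | C
      · exact (e1i _ inferInstance C A).elim
      · -- 0 ↦ ∞, ∞ ↦ 0, 1 ↦ 1
        have := core H.inv.1 H.inv.2 (ii.comp A) (t_inv_one.comp C) (i0.comp B)
        refine Or.inr (Or.inr (Or.inl fun z hz => ?_))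
        have e : (h z)⁻¹ = z := this z hz
        exact inv_eq_iff_eq_inv.1 e
      · exact (e01 _ inferInstance B C).elim
  · rcases B' with B | B | B
    · rcases C' with C | C | C
      · exact (e01 _ inferInstance B C).elim
      · exact (e1i _ inferInstance C A).elim
      · -- 1 ↦ ∞, 0 ↦ 0, ∞ ↦ 1
        have := core H.inv.sub.inv.1 H.inv.sub.inv.2
          (ii.comp (t_sub_inf.comp (i0.comp B))) (t_inv_one.comp (t_sub_zero.comp (ii.comp A)))
          (i0.comp (t_sub_one.comp (t_inv_one.comp C)))
        refine Or.inr (Or.inr (Or.inr (Or.inr (Or.inl fun z hz => ?_))))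
        have e : (1 - (h z)⁻¹)⁻¹ = z := this z hz
        have hz0 := (mem_X.1 hz).1
        have hz1 : z - 1 ≠ 0 := sub_ne_zero.2 (mem_X.1 hz).2
        rw [inv_eq_iff_eq_inv] at e
        have e2 : (h z)⁻¹ = (z - 1) / z := by
          have : (h z)⁻¹ = 1 - z⁻¹ := by rw [← e]; ring
          rw [this]; field_simp
        rw [← inv_inv (h z), e2, inv_div]
    · exact (e0i _ inferInstance B A).elim
    · rcases C' with C | C | C
      · -- 0 ↦ 1, 1 ↦ ∞, ∞ ↦ 0 : 1 - 1/h
        have := core H.inv.sub.1 H.inv.sub.2 (t_sub_one.comp (t_inv_one.comp C))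
          (t_sub_zero.comp (ii.comp A)) (t_sub_inf.comp (i0.comp B))
        refine Or.inr (Or.inr (Or.inr (Or.inl fun z hz => ?_)))
        have e : 1 - (h z)⁻¹ = z := this z hz
        rw [show 1 - z = (h z)⁻¹ by linear_combination e, inv_inv]
      · exact (e1i _ inferInstance C A).elim
      · exact (e01 _ inferInstance B C).elim
  · rcases B' with B | B | B
    · rcases C' with C | C | C
      · exact (e01 _ inferInstance B C).elim
      · exact Or.inl (core H.1 H.2 B C A)
      · exact (e1i _ inferInstance C A).elim
    · rcases C' with C | C | C
      · have := core H.sub.1 H.sub.2 (t_sub_one.comp C) (t_sub_zero.comp B) (t_sub_inf.comp A)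
        refine Or.inr (Or.inl fun z hz => ?_)
        have e : 1 - h z = z := this z hz
        linear_combination -e
      · exact (e01 _ inferInstance B C).elim
      · exact (e1i _ inferInstance C A).elim
    · exact (e0i _ inferInstance B A).elim
end

section
/- The set of nonconstant holomorphic self-maps of ℂ ∖ {0,1} has exactly six elements, namely the restrictions to ℂ ∖ {0,1} of the Möbius transformations z ↦ z, z ↦ 1 − z, z ↦ 1/z, z ↦ 1/(1 − z), z ↦ z/(z − 1), z ↦ (z − 1)/z. In particular, every nonconstant holomorphic self-map of ℂ ∖ {0,1} is an automorphism, and this set of maps is finite. -/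
open Set

open Metric in
lemma aux_log_s10 (g : ℂ → ℂ) (hg : DifferentiableOn ℂ g (ball 0 1)) (h0 : ∀ z ∈ ball (0:ℂ) 1, g z ≠ 0) :
    ∃ l : ℂ → ℂ, DifferentiableOn ℂ l (ball 0 1) ∧ ∀ z ∈ ball (0:ℂ) 1, Complex.exp (l z) = g z := by
  have hd : DifferentiableOn ℂ (fun z => deriv g z / g z) (ball 0 1) :=
    (hg.deriv isOpen_ball).div hg h0
  obtain ⟨P, hP⟩ := hd.isExactOn_ball
  have h00 : (0:ℂ) ∈ ball (0:ℂ) 1 := by simp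
  have hq : ∀ z ∈ ball (0:ℂ) 1, HasDerivAt (fun z => g z * Complex.exp (-P z)) 0 z := by
    intro z hz
    have h1 := (hg.differentiableAt (isOpen_ball.mem_nhds hz)).hasDerivAt
    have h2 := (hP z hz).neg.cexp
    have := h0 z hz
    refine (h1.mul h2).congr_deriv ?_
    simp only [Pi.neg_apply]
    field_simp
    ring
  have hc : ∀ z ∈ ball (0:ℂ) 1, g z * Complex.exp (-P z) = g 0 * Complex.exp (-P 0) := by
    intro z hz
    exact isOpen_ball.is_const_of_deriv_eq_zero (convex_ball _ _).isPreconnected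
      (fun z hz => (hq z hz).differentiableAt.differentiableWithinAt)
      (fun z hz => (hq z hz).deriv) hz h00
  refine ⟨fun z => P z + Complex.log (g 0 * Complex.exp (-P 0)), ?_, ?_⟩
  · exact fun z hz => ((hP z hz).differentiableAt.add_const _).differentiableWithinAt
  · intro z hz
    rw [Complex.exp_add, Complex.exp_log (by simp [h0 0 h00]), ← hc z hz, Complex.exp_neg]
    field_simp

open Metric in
lemma aux_cos_lift (F : ℂ → ℂ) (hF : DifferentiableOn ℂ F (ball 0 1))
    (h1 : ∀ z ∈ ball (0:ℂ) 1, F z ≠ 1) (h2 : ∀ z ∈ ball (0:ℂ) 1, F z ≠ -1) (a : ℂ)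
    (ha : Complex.cos (Real.pi * a) = F 0) :
    ∃ G : ℂ → ℂ, DifferentiableOn ℂ G (ball 0 1) ∧ G 0 = a ∧
      ∀ z ∈ ball (0:ℂ) 1, Complex.cos (Real.pi * G z) = F z := by
  have hpi : (Real.pi : ℂ) ≠ 0 := by exact_mod_cast Real.pi_ne_zero
  have h00 : (0:ℂ) ∈ ball (0:ℂ) 1 := by simp
  obtain ⟨l, hl, hle⟩ := aux_log_s10 (fun z => F z ^ 2 - 1) ((hF.pow 2).sub_const 1) (by
    intro z hz h
    have : (F z - 1) * (F z + 1) = 0 := by linear_combination h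
    rcases mul_eq_zero.1 this with h | h
    · exact h1 z hz (by linear_combination h)
    · exact h2 z hz (by linear_combination h))
  have hS : ∀ z ∈ ball (0:ℂ) 1, Complex.exp (l z / 2) ^ 2 = F z ^ 2 - 1 := by
    intro z hz
    rw [← hle z hz, ← Complex.exp_nat_mul]
    congr 1; push_cast; ring
  obtain ⟨m, hm, hme⟩ := aux_log_s10 (fun z => F z + Complex.exp (l z / 2))
    (hF.add ((hl.div_const 2).cexp)) (by
      intro z hz h
      have := hS z hz
      have h' : Complex.exp (l z / 2) = - F z := by linear_combination h
      rw [h'] at this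
      have : (1:ℂ) = 0 := by linear_combination this
      exact one_ne_zero this)
  have hcos : ∀ z ∈ ball (0:ℂ) 1, Complex.cos (-Complex.I * m z) = F z := by
    intro z hz
    have e1 : Complex.exp (-Complex.I * m z * Complex.I) = F z + Complex.exp (l z / 2) := by
      rw [← hme z hz]; congr 1; linear_combination (-m z) * Complex.I_mul_I
    have hne : F z + Complex.exp (l z / 2) ≠ 0 := by
      rw [← e1]; exact Complex.exp_ne_zero _
    have e2 : Complex.exp (-(-Complex.I * m z) * Complex.I) = F z - Complex.exp (l z / 2) := by
      rw [neg_mul, Complex.exp_neg, e1]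
      apply inv_eq_of_mul_eq_one_right
      linear_combination - hS z hz
    rw [Complex.cos, e1, e2]; ring
  have h0 := hcos 0 h00
  rw [← ha, Complex.cos_eq_cos_iff] at h0
  obtain ⟨k, hk | hk⟩ := h0
  · refine ⟨fun z => (-Complex.I * m z) / Real.pi + 2 * k, ?_, ?_, ?_⟩
    · exact ((hm.const_mul _).div_const _).add_const _
    · field_simp; linear_combination -hk
    · intro z hz
      rw [← hcos z hz, eq_comm, Complex.cos_eq_cos_iff]
      exact ⟨k, Or.inl (by field_simp; ring)⟩
  · refine ⟨fun z => -(-Complex.I * m z) / Real.pi + 2 * k, ?_, ?_, ?_⟩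
    · exact (((hm.const_mul _).neg).div_const _).add_const _
    · field_simp; linear_combination -hk
    · intro z hz
      rw [← hcos z hz, eq_comm, Complex.cos_eq_cos_iff]
      exact ⟨k, Or.inr (by field_simp; ring)⟩

lemma aux_gap (w : ℂ) : ∃ p : ℂ, dist p w < 2 ∧ ∃ n : ℤ, Complex.cos (Real.pi * p) = n := by
  have key : ∀ y : ℝ, 0 ≤ y → ∃ y' : ℝ, |y' - y| ≤ 1 ∧ ∃ n : ℤ, Real.cosh (Real.pi * y') = n := by
    intro y hy
    have hpi := Real.pi_gt_three
    have h1 : Real.cosh (Real.pi * y) + 1 ≤ Real.cosh (Real.pi * (y + 1)) := by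
      rw [mul_add, mul_one, Real.cosh_add]
      have a1 : 1 ≤ Real.cosh (Real.pi * y) := Real.one_le_cosh _
      have a2 : 2 ≤ Real.cosh Real.pi := by
        rw [Real.cosh_eq]
        have := Real.add_one_le_exp Real.pi
        have := Real.exp_pos (-Real.pi)
        linarith
      have a3 : 0 ≤ Real.sinh (Real.pi * y) := Real.sinh_nonneg_iff.2 (by positivity)
      have a4 : 0 ≤ Real.sinh (Real.pi) := Real.sinh_nonneg_iff.2 (by positivity)
      nlinarith [mul_nonneg a3 a4]
    have hc : ContinuousOn (fun t => Real.cosh (Real.pi * t)) (Icc y (y+1)) := by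
      have := Real.continuous_cosh
      fun_prop
    have hm : ((⌈Real.cosh (Real.pi * y)⌉ : ℤ) : ℝ) ∈
        Icc (Real.cosh (Real.pi * y)) (Real.cosh (Real.pi * (y+1))) :=
      ⟨Int.le_ceil _, by linarith [Int.ceil_lt_add_one (Real.cosh (Real.pi * y))]⟩
    obtain ⟨t, ht, hte⟩ := intermediate_value_Icc (by linarith) hc hm
    exact ⟨t, by rw [abs_le]; constructor <;> linarith [ht.1, ht.2], _, hte⟩
  have key2 : ∃ y' : ℝ, |y' - w.im| ≤ 1 ∧ ∃ n : ℤ, Real.cosh (Real.pi * y') = n := by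
    rcases le_total 0 w.im with h | h
    · exact key _ h
    · obtain ⟨y, hy, n, hn⟩ := key (-w.im) (by linarith)
      refine ⟨-y, ?_, n, by rw [mul_neg, Real.cosh_neg, hn]⟩
      rw [← abs_neg]; convert hy using 2; ring
  obtain ⟨y, hy, n, hn⟩ := key2
  have hcos : ∃ e : ℤ, Complex.cos ((round w.re : ℂ) * Real.pi) = e := by
    have h1 : Complex.cos ((round w.re : ℂ) * Real.pi) = ((-1 : ℝ)^(round w.re) : ℝ) := by
      rw [← Real.cos_int_mul_pi (round w.re)]; push_cast; rfl
    rw [h1]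
    rcases Int.even_or_odd (round w.re) with h | h
    · exact ⟨1, by rw [h.neg_one_zpow]; simp⟩
    · exact ⟨-1, by rw [h.neg_one_zpow]; simp⟩
  obtain ⟨e, he⟩ := hcos
  refine ⟨(round w.re : ℂ) + y * Complex.I, ?_, e * n, ?_⟩
  · rw [dist_eq_norm]
    refine (Complex.norm_le_abs_re_add_abs_im _).trans_lt ?_
    have := abs_sub_round w.re
    rw [abs_sub_comm] at this
    simp
    linarith
  · have : (Real.pi : ℂ) * ((round w.re : ℂ) + y * Complex.I)
      = (round w.re : ℂ) * Real.pi + ((Real.pi * y : ℝ) : ℂ) * Complex.I := by push_cast; ring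
    rw [this, Complex.cos_add, Complex.cos_mul_I, Complex.sin_int_mul_pi, ← Complex.ofReal_cosh, hn,
      he]
    simp

open Metric in
lemma aux_bloch_s10 (h : ℂ → ℂ) (c : ℂ) (R R' : ℝ) (hR : 0 < R) (hRR : R < R')
    (hd : DifferentiableOn ℂ h (ball c R'))
    (hom : ∀ w, ∃ p, dist p w < 2 ∧ p ∉ h '' ball c R') : R * ‖deriv h c‖ ≤ 128 := by
  have hd' := hd.deriv isOpen_ball
  have hcont : ContinuousOn (fun z => (R - dist z c) * ‖deriv h z‖) (closedBall c R) := by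
    refine ContinuousOn.mul (by fun_prop) ?_
    exact (hd'.continuousOn.mono (closedBall_subset_ball hRR)).norm
  obtain ⟨a, ha, hmax⟩ := (isCompact_closedBall c R).exists_isMaxOn ⟨c, by simp [hR.le]⟩ hcont
  have hmc := hmax (show c ∈ closedBall c R by simp [hR.le])
  simp only [mem_ofPred_eq, dist_self, sub_zero] at hmc
  refine hmc.trans ?_
  by_contra! hcon
  rw [mem_closedBall] at ha
  set D := ‖deriv h a‖ with hD
  have hDpos : 0 < D := by
    rcases (norm_nonneg (deriv h a)).lt_or_eq with h | h
    · exact h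
    · rw [hD, ← h] at hcon; norm_num at hcon
  obtain ⟨r, hr⟩ : ∃ r, R - dist a c = 2 * r := ⟨(R - dist a c) / 2, by ring⟩
  rw [hr] at hcon
  have hrpos : 0 < r := by
    by_contra! hh
    nlinarith
  have hsub : ball a r ⊆ closedBall c R := by
    intro z hz
    rw [mem_ball] at hz
    rw [mem_closedBall]
    linarith [dist_triangle z a c]
  have hsub' : ball a r ⊆ ball c R' := hsub.trans (closedBall_subset_ball hRR)
  have hb : ∀ z ∈ ball a r, ‖deriv h z‖ ≤ 2 * D := by
    intro z hz
    have h1 := hmax (hsub hz)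
    simp only [mem_ofPred_eq] at h1
    rw [hr] at h1
    rw [mem_ball] at hz
    have h2 : r ≤ R - dist z c := by linarith [dist_triangle z a c]
    have h3 : r * ‖deriv h z‖ ≤ (R - dist z c) * ‖deriv h z‖ := by gcongr
    have h4 : r * ‖deriv h z‖ ≤ r * (2 * D) := by rw [hD]; linarith
    exact le_of_mul_le_mul_left h4 hrpos
  have hs : ∀ z ∈ ball a r, ‖deriv h z - deriv h a‖ ≤ 3 * D / r * dist z a := by
    intro z hz
    rw [← dist_eq_norm]
    refine Complex.dist_le_div_mul_dist_of_mapsTo_ball (hd'.mono hsub') ?_ hz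
    intro y hy
    rw [mem_closedBall, dist_eq_norm]
    refine (norm_sub_le _ _).trans ?_
    linarith [hb y hy]
  have hsub8 : closedBall a (r/8) ⊆ ball a r := closedBall_subset_ball (by linarith)
  have hs8 : ∀ z ∈ closedBall a (r/8), ‖deriv h z - deriv h a‖ ≤ D / 2 := by
    intro z hz
    refine (hs z (hsub8 hz)).trans ?_
    rw [mem_closedBall] at hz
    calc 3 * D / r * dist z a ≤ 3 * D / r * (r / 8) := by gcongr
      _ = 3 * D / 8 := by field_simp
      _ ≤ _ := by linarith
  have hda : ∀ z ∈ ball a r, DifferentiableAt ℂ h z := fun z hz =>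
    hd.differentiableAt (isOpen_ball.mem_nhds (hsub' hz))
  have hmv : ∀ z ∈ closedBall a (r/8), ‖h z - h a‖ ≥ D / 2 * dist z a := by
    intro z hz
    have := (convex_closedBall a (r/8)).norm_image_sub_le_of_norm_hasDerivWithin_le
      (f := fun z => h z - deriv h a * z) (f' := fun z => deriv h z - deriv h a) (C := D/2)
      (x := a) (y := z)
      (fun x hx => by
        have h1 := (hda x (hsub8 hx)).hasDerivAt
        have h2 := (hasDerivAt_id x).const_mul (deriv h a)
        simp only [mul_one, id] at h2
        exact (h1.sub h2).hasDerivWithinAt) hs8 (by simp; linarith) hz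
    have e : deriv h a * (z - a) = (h z - h a) - ((h z - deriv h a * z) - (h a - deriv h a * a)) := by
      ring
    have e2 : D * ‖z - a‖ ≤ ‖h z - h a‖ + D / 2 * ‖z - a‖ := by
      rw [hD, ← norm_mul, e]
      exact (norm_sub_le _ _).trans (by linarith)
    rw [dist_eq_norm]; linarith
  have hball : ball (h a) (D * r / 16 / 2) ⊆ h '' closedBall a (r/8) := by
    refine DiffContOnCl.ball_subset_image_closedBall ?_ (by linarith) ?_ ?_
    · apply DifferentiableOn.diffContOnCl
      exact (hd.mono hsub').mono ((closure_ball_subset_closedBall).trans hsub8)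
    · intro z hz
      have := hmv z (sphere_subset_closedBall hz)
      rw [mem_sphere] at hz
      rw [hz] at this
      linarith
    · have : ∀ᶠ z in nhdsWithin a {a}ᶜ, h z ≠ h a := by
        have h1 : ∀ᶠ z in nhdsWithin a {a}ᶜ, z ∈ closedBall a (r/8) :=
          mem_nhdsWithin_of_mem_nhds (closedBall_mem_nhds _ (by linarith))
        filter_upwards [h1, self_mem_nhdsWithin] with z hz hza heq
        have := hmv z hz
        rw [heq, sub_self, norm_zero] at this
        have h3 : 0 < dist z a := dist_pos.2 hza
        have : 0 < D / 2 * dist z a := by positivity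
        linarith
      exact this.frequently.filter_mono nhdsWithin_le_nhds
  obtain ⟨p, hp, hpn⟩ := hom (h a)
  apply hpn
  have : p ∈ ball (h a) (D * r / 16 / 2) := by
    rw [mem_ball]
    linarith
  exact image_mono (hsub8.trans hsub') (hball this)

lemma aux_schottky_s10 : ∃ M ε : ℝ, 0 < ε ∧ ∀ F : ℂ → ℂ, DifferentiableOn ℂ F (Metric.ball 0 1) →
    (∀ z ∈ Metric.ball (0:ℂ) 1, F z ≠ 1) → (∀ z ∈ Metric.ball (0:ℂ) 1, F z ≠ -1) → ‖F 0‖ < ε →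
    ∀ z ∈ Metric.closedBall (0:ℂ) (1/2), ‖F z‖ ≤ M := by
  open Metric in
  let Φ : ℂ → ℂ := fun z => Complex.cos (Real.pi * Complex.cos (Real.pi * z))
  have hpi : (Real.pi : ℂ) ≠ 0 := by exact_mod_cast Real.pi_ne_zero
  have hΦc : Continuous Φ := by fun_prop
  obtain ⟨M, hM⟩ := (isCompact_closedBall (0:ℂ) 258).exists_bound_of_continuousOn hΦc.continuousOn
  have e3 : (Real.pi : ℂ) * (1/3) = ((Real.pi / 3 : ℝ) : ℂ) := by push_cast; ring
  have c3 : Complex.cos (Real.pi * (1/3)) = 1/2 := by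
    rw [e3, ← Complex.ofReal_cos, Real.cos_pi_div_three]; push_cast; rfl
  have s3 : Complex.sin (Real.pi * (1/3)) ≠ 0 := by
    rw [e3, ← Complex.ofReal_sin, Real.sin_pi_div_three]; norm_cast; positivity
  have e2 : (Real.pi : ℂ) * (1/2) = Real.pi / 2 := by ring
  have hΦ0 : Φ (1/3) = 0 := by
    simp only [Φ]; rw [c3, e2, Complex.cos_pi_div_two]
  have hder : HasStrictDerivAt Φ (-Complex.sin (Real.pi * Complex.cos (Real.pi * (1/3))) *
      (Real.pi * (-Complex.sin (Real.pi * (1/3)) * Real.pi))) (1/3) := by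
    have h1 : HasStrictDerivAt (fun z : ℂ => (Real.pi : ℂ) * z) Real.pi (1/3) := by
      simpa using (hasStrictDerivAt_id (1/3 : ℂ)).const_mul (Real.pi : ℂ)
    exact ((h1.ccos).const_mul (Real.pi:ℂ)).ccos
  have hmap := hder.map_nhds_eq (by
    rw [c3, e2, Complex.sin_pi_div_two]
    exact mul_ne_zero (by simp) (mul_ne_zero hpi (mul_ne_zero (neg_ne_zero.2 s3) hpi)))
  rw [hΦ0] at hmap
  have hmem : Φ '' ball (1/3) 1 ∈ nhds (0:ℂ) := by
    rw [← hmap]; exact Filter.image_mem_map (ball_mem_nhds _ one_pos)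
  obtain ⟨ε, hε, hsub⟩ := Metric.mem_nhds_iff.1 hmem
  refine ⟨M, ε, hε, ?_⟩
  intro F hF hF1 hF2 hF0 z hz
  have hF0' : F 0 ∈ ball (0:ℂ) ε := by simpa using hF0
  obtain ⟨a, ha, haF⟩ := hsub hF0'
  obtain ⟨G, hG, hG0, hGe⟩ := aux_cos_lift F hF hF1 hF2 (Complex.cos (Real.pi * a)) haF
  obtain ⟨H, hH, hH0, hHe⟩ := aux_cos_lift G hG
    (fun z hz h => hF2 z hz (by rw [← hGe z hz, h]; simp))
    (fun z hz h => hF2 z hz (by rw [← hGe z hz, h]; simp)) a hG0.symm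
  have hom : ∀ w, ∃ p, dist p w < 2 ∧ p ∉ H '' ball 0 1 := by
    intro w
    obtain ⟨p, hp, n, hn⟩ := aux_gap w
    refine ⟨p, hp, ?_⟩
    rintro ⟨x, hx, rfl⟩
    rw [hHe x hx] at hn
    have h1 := hGe x hx
    rw [hn] at h1
    have h2 : Complex.cos ((Real.pi:ℂ) * n) = ((-1 : ℝ)^n : ℝ) := by
      rw [← Real.cos_int_mul_pi n, mul_comm]; push_cast; rfl
    rw [h2] at h1
    rcases Int.even_or_odd n with h | h
    · rw [h.neg_one_zpow] at h1
      exact hF1 x hx (by rw [← h1]; simp)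
    · rw [h.neg_one_zpow] at h1
      exact hF2 x hx (by rw [← h1]; simp)
  have hdb : ∀ x ∈ closedBall (0:ℂ) (1/2), ‖deriv H x‖ ≤ 512 := by
    intro x hx
    have hs : ball x (1/2) ⊆ ball (0:ℂ) 1 := by
      apply ball_subset_ball'
      rw [mem_closedBall] at hx; linarith
    have := aux_bloch_s10 H x (1/4) (1/2) (by norm_num) (by norm_num) (hH.mono hs) (fun w => by
      obtain ⟨p, hp, hn⟩ := hom w
      exact ⟨p, hp, fun h => hn (image_mono hs h)⟩)
    linarith
  have hcs : closedBall (0:ℂ) (1/2) ⊆ ball 0 1 := closedBall_subset_ball (by norm_num)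
  have hb := (convex_closedBall (0:ℂ) (1/2)).norm_image_sub_le_of_norm_deriv_le
    (fun x hx => hH.differentiableAt (isOpen_ball.mem_nhds (hcs hx))) hdb
    (show (0:ℂ) ∈ closedBall (0:ℂ) (1/2) by simp) hz
  rw [sub_zero, hH0] at hb
  rw [mem_closedBall, dist_zero_right] at hz
  have hHz : H z ∈ closedBall (0:ℂ) 258 := by
    rw [mem_closedBall, dist_zero_right]
    rw [mem_ball, dist_eq_norm] at ha
    have h3 : ‖(1/3:ℂ)‖ ≤ 1 := by norm_num
    calc ‖H z‖ = ‖(H z - a) + (a - 1/3) + 1/3‖ := by congr 1; ring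
      _ ≤ ‖H z - a‖ + ‖a - 1/3‖ + ‖(1/3:ℂ)‖ := norm_add₃_le
      _ ≤ 258 := by linarith
  have := hM _ hHz
  simp only [Φ] at this
  rwa [hHe z (hcs (by simpa using hz)), hGe z (hcs (by simpa using hz))] at this

open Filter Topology Metric in
lemma aux_mero_bdd (f : ℂ → ℂ) (hd : ∀ᶠ z in 𝓝[≠] (0:ℂ), DifferentiableAt ℂ f z) (M : ℝ)
    (hb : ∀ᶠ z in 𝓝[≠] (0:ℂ), ‖f z‖ ≤ M) : MeromorphicAt f 0 := by
  have h := hd.and hb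
  rw [eventually_nhdsWithin_iff] at h
  obtain ⟨s, hs, hss⟩ := Metric.eventually_nhds_iff_ball.1 h
  have hnh : ball (0:ℂ) s ∈ 𝓝 (0:ℂ) := ball_mem_nhds _ hs
  have := Complex.differentiableOn_update_limUnder_of_bddAbove (f := f) hnh
    (fun z hz => (hss z hz.1 hz.2).1.differentiableWithinAt) ⟨M, by
      rintro _ ⟨z, hz, rfl⟩
      exact (hss z hz.1 hz.2).2⟩
  refine (this.analyticAt hnh).meromorphicAt.congr ?_
  filter_upwards [self_mem_nhdsWithin] with z hz
  simp [Function.update_of_ne hz]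

open Filter Topology Metric in
lemma aux_picard (f : ℂ → ℂ)
    (hf : ∀ᶠ z in 𝓝[≠] (0:ℂ), DifferentiableAt ℂ f z ∧ f z ≠ 1 ∧ f z ≠ -1) :
    MeromorphicAt f 0 := by
  obtain ⟨M, ε, hε, hS⟩ := aux_schottky_s10
  by_cases hA : ∀ᶠ z in 𝓝[≠] (0:ℂ), ε ≤ ‖f z‖
  · have : MeromorphicAt (fun z => (f z)⁻¹) 0 := by
      refine aux_mero_bdd _ ?_ ε⁻¹ ?_
      · filter_upwards [hf, hA] with z h1 h2
        exact h1.1.inv (norm_pos_iff.1 (hε.trans_le h2))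
      · filter_upwards [hA] with z h2
        rw [norm_inv]; gcongr
    have h2 := this.inv
    refine h2.congr ?_
    exact Eventually.of_forall (fun z => by simp)
  · have hB : ∃ᶠ z in 𝓝[≠] (0:ℂ), ‖f z‖ < ε := by
      rw [Filter.not_eventually] at hA
      exact hA.mono (fun z hz => not_le.1 hz)
    rw [eventually_nhdsWithin_iff] at hf
    obtain ⟨r, hr, hrs⟩ := Metric.eventually_nhds_iff_ball.1 hf
    have hfreq : ∀ δ > 0, ∃ z : ℂ, z ≠ 0 ∧ ‖z‖ < δ ∧ ‖f z‖ < ε := by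
      intro δ hδ
      have h1 : ∀ᶠ z in 𝓝[≠] (0:ℂ), z ∈ ball (0:ℂ) δ ∧ z ≠ 0 :=
        Filter.Eventually.and (mem_nhdsWithin_of_mem_nhds (ball_mem_nhds _ hδ)) self_mem_nhdsWithin
      obtain ⟨z, hz, h2⟩ := (hB.and_eventually h1).exists
      exact ⟨z, h2.2, by simpa using h2.1, hz⟩
    have hcirc : ∀ z₀ : ℂ, z₀ ≠ 0 → ‖z₀‖ < r * Real.exp (-(2 * Real.pi)) → ‖f z₀‖ < ε →
        ∀ z : ℂ, ‖z‖ = ‖z₀‖ → ‖f z‖ ≤ M := by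
      intro z₀ hz0 hz0r hfz z hz
      have hmaps : ∀ w ∈ ball (0:ℂ) 1, z₀ * Complex.exp (2 * Real.pi * Complex.I * w) ∈ ball (0:ℂ) r ∧
          z₀ * Complex.exp (2 * Real.pi * Complex.I * w) ≠ 0 := by
        intro w hw
        refine ⟨?_, mul_ne_zero hz0 (Complex.exp_ne_zero _)⟩
        rw [mem_ball, dist_zero_right] at hw ⊢
        rw [norm_mul, Complex.norm_exp]
        have h1 : (2 * Real.pi * Complex.I * w).re = -(2 * Real.pi * w.im) := by simp
        have h2 : -w.im ≤ 1 := by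
          have := Complex.abs_im_le_norm w
          linarith [neg_le_abs w.im]
        rw [h1]
        have h3 : Real.exp (-(2 * Real.pi * w.im)) ≤ Real.exp (2 * Real.pi) := by
          apply Real.exp_le_exp.2
          nlinarith [Real.pi_pos]
        calc ‖z₀‖ * Real.exp (-(2 * Real.pi * w.im)) ≤ ‖z₀‖ * Real.exp (2 * Real.pi) := by gcongr
          _ < r * Real.exp (-(2 * Real.pi)) * Real.exp (2 * Real.pi) := by gcongr
          _ = r := by rw [mul_assoc, ← Real.exp_add]; simp
      have hF := hS (fun w => f (z₀ * Complex.exp (2 * Real.pi * Complex.I * w)))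
        (fun w hw => by
          have h1 := (hrs _ (hmaps w hw).1 (hmaps w hw).2).1
          refine DifferentiableAt.differentiableWithinAt ?_
          exact DifferentiableAt.comp w h1 (by fun_prop))
        (fun w hw => (hrs _ (hmaps w hw).1 (hmaps w hw).2).2.1)
        (fun w hw => (hrs _ (hmaps w hw).1 (hmaps w hw).2).2.2)
        (by simpa using hfz)
      have hq : ‖z / z₀‖ = 1 := by
        rw [norm_div, hz, div_self (norm_ne_zero_iff.2 hz0)]
      have hzz : z = z₀ * Complex.exp (2 * Real.pi * Complex.I *
          (((Complex.arg (z / z₀)) / (2 * Real.pi) : ℝ) : ℂ)) := by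
        have := Complex.norm_mul_exp_arg_mul_I (z / z₀)
        rw [hq] at this
        have hpi : (Real.pi : ℂ) ≠ 0 := by exact_mod_cast Real.pi_ne_zero
        have e : 2 * Real.pi * Complex.I * (((Complex.arg (z / z₀)) / (2 * Real.pi) : ℝ) : ℂ)
          = (Complex.arg (z / z₀)) * Complex.I := by push_cast; field_simp
        rw [e]
        simp only [Complex.ofReal_one, one_mul] at this
        rw [this]; field_simp
      rw [hzz]
      apply hF
      rw [mem_closedBall, dist_zero_right, Complex.norm_real, Real.norm_eq_abs, abs_div,
        abs_of_pos (show 0 < 2 * Real.pi by positivity), div_le_iff₀ (by positivity)]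
      have := Complex.abs_arg_le_pi (z / z₀)
      linarith
    obtain ⟨z₁, hz1, hz1r, hz1f⟩ := hfreq (r * Real.exp (-(2 * Real.pi))) (by positivity)
    have hz1r' : ‖z₁‖ < r := hz1r.trans_le (by
      have : Real.exp (-(2 * Real.pi)) ≤ 1 := Real.exp_le_one_iff.2 (by linarith [Real.pi_pos])
      nlinarith)
    refine aux_mero_bdd f ?_ M ?_
    · rw [eventually_nhdsWithin_iff]
      filter_upwards [hf] with z hz h
      exact (hz h).1
    · have h1 : ∀ᶠ z in 𝓝[≠] (0:ℂ), z ∈ ball (0:ℂ) ‖z₁‖ ∧ z ≠ 0 :=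
        Filter.Eventually.and (mem_nhdsWithin_of_mem_nhds (ball_mem_nhds _ (norm_pos_iff.2 hz1)))
          self_mem_nhdsWithin
      filter_upwards [h1] with z ⟨hz, hzne⟩
      obtain ⟨z₂, hz2, hz2r, hz2f⟩ := hfreq (min ‖z‖ (r * Real.exp (-(2 * Real.pi))))
        (lt_min (norm_pos_iff.2 hzne) (by positivity))
      rw [lt_min_iff] at hz2r
      have hz2p : 0 < ‖z₂‖ := norm_pos_iff.2 hz2
      set U : Set ℂ := ball (0:ℂ) ‖z₁‖ \ closedBall (0:ℂ) ‖z₂‖ with hU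
      have hUo : IsOpen U := isOpen_ball.sdiff isClosed_closedBall
      have hcl : closure U ⊆ {x | ‖z₂‖ ≤ ‖x‖ ∧ ‖x‖ ≤ ‖z₁‖} := by
        apply closure_minimal
        · rintro x ⟨hx1, hx2⟩
          simp only [mem_ball, mem_closedBall, dist_zero_right, not_le] at hx1 hx2
          exact ⟨hx2.le, hx1.le⟩
        · exact (isClosed_le continuous_const continuous_norm).inter
            (isClosed_le continuous_norm continuous_const)
      refine Complex.norm_le_of_forall_mem_frontier_norm_le (U := U)
        (isBounded_ball.subset sdiff_subset) ?_ ?_ (subset_closure ⟨hz, ?_⟩)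
      · apply DifferentiableOn.diffContOnCl
        intro x hx
        have := hcl hx
        refine (hrs x ?_ ?_).1.differentiableWithinAt
        · simp; linarith [this.2]
        · exact norm_pos_iff.1 (hz2p.trans_le this.1)
      · intro x hx
        rw [hUo.frontier_eq] at hx
        have h2 := hcl hx.1
        have h3 := hx.2
        simp only [hU, Set.mem_sdiff, mem_ball, mem_closedBall, dist_zero_right, not_and, not_not] at h3
        rcases h2.2.lt_or_eq with h | h
        · exact hcirc z₂ hz2 hz2r.2 hz2f x (le_antisymm (h3 h) h2.1)
        · exact hcirc z₁ hz1 hz1r hz1f x h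
      · simpa using hz2r.1
lemma aux_open : IsOpen (({0, 1} : Set ℂ)ᶜ) :=
  ((Set.finite_singleton (1:ℂ)).insert 0).isClosed.isOpen_compl

open Filter Topology in
lemma aux_ev (z : ℂ) : ∀ᶠ x in 𝓝[≠] z, x ∈ (({0, 1} : Set ℂ)ᶜ) := by
  have h : (({0,1} : Set ℂ) \ {z})ᶜ ∈ 𝓝 z := by
    refine IsOpen.mem_nhds ?_ (by simp)
    exact (((Set.finite_singleton (1:ℂ)).insert 0).subset sdiff_subset).isClosed.isOpen_compl
  filter_upwards [mem_nhdsWithin_of_mem_nhds h, self_mem_nhdsWithin] with x hx hxz hx2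
  exact hx ⟨hx2, hxz⟩

open Filter Topology in
lemma aux_comp (f : ℂ → ℂ) (hf : DifferentiableOn ℂ f ({0, 1} : Set ℂ)ᶜ)
    (hm : MapsTo f ({0, 1} : Set ℂ)ᶜ ({0, 1} : Set ℂ)ᶜ) (φ : ℂ → ℂ)
    (hφ : ∀ᶠ z in 𝓝[≠] (0:ℂ), DifferentiableAt ℂ φ z ∧ φ z ∈ ({0, 1} : Set ℂ)ᶜ) :
    MeromorphicAt (fun z => f (φ z)) 0 := by
  have h : MeromorphicAt (fun z => 2 * f (φ z) - 1) 0 := by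
    apply aux_picard
    filter_upwards [hφ] with z hz
    have h1 := hm hz.2
    simp only [mem_compl_iff, mem_insert_iff, mem_singleton_iff, not_or] at h1
    have h2 := hf.differentiableAt (aux_open.mem_nhds hz.2)
    refine ⟨((h2.comp z hz.1).const_mul 2).sub_const 1, ?_, ?_⟩
    · intro h; exact h1.2 (by linear_combination h / 2)
    · intro h; exact h1.1 (by linear_combination h / 2)
  have h2 : MeromorphicAt (fun z => (2 * f (φ z) - 1 + 1) / 2) 0 := by fun_prop
  exact h2.congr (Eventually.of_forall (fun z => by ring))

open Filter Topology in
lemma aux_mero (f : ℂ → ℂ) (hf : DifferentiableOn ℂ f ({0, 1} : Set ℂ)ᶜ)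
    (hm : MapsTo f ({0, 1} : Set ℂ)ᶜ ({0, 1} : Set ℂ)ᶜ) : ∀ z, MeromorphicAt f z := by
  intro z
  have h := aux_comp f hf hm (fun x => x + z) (by
    have h1 : Tendsto (fun x => x + z) (𝓝[≠] 0) (𝓝[≠] z) := by
      refine tendsto_nhdsWithin_iff.2 ⟨?_, ?_⟩
      · have : Continuous (fun x => x + z) := by fun_prop
        exact (this.tendsto' 0 z (by simp)).mono_left nhdsWithin_le_nhds
      · filter_upwards [self_mem_nhdsWithin] with x hx
        simpa using hx
    filter_upwards [h1.eventually (aux_ev z)] with x hx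
    exact ⟨by fun_prop, hx⟩)
  have h2 := MeromorphicAt.comp_analyticAt (x := z) (g := fun x => x - z)
    (f := fun x => f (x + z)) (by simpa using h) (by fun_prop)
  simpa [Function.comp_def] using h2

open Filter Topology in
lemma aux_mero_inf (f : ℂ → ℂ) (hf : DifferentiableOn ℂ f ({0, 1} : Set ℂ)ᶜ)
    (hm : MapsTo f ({0, 1} : Set ℂ)ᶜ ({0, 1} : Set ℂ)ᶜ) : MeromorphicAt (fun z => f z⁻¹) 0 := by
  apply aux_comp f hf hm
  filter_upwards [aux_ev 0] with x hx
  simp only [mem_compl_iff, mem_insert_iff, mem_singleton_iff, not_or] at hx ⊢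
  refine ⟨differentiableAt_inv hx.1, by simpa using hx.1, by simpa using hx.2⟩

open Filter Topology in
lemma aux_factor (f : ℂ → ℂ) (hf : DifferentiableOn ℂ f ({0, 1} : Set ℂ)ᶜ)
    (hne : ∀ z ∈ ({0, 1} : Set ℂ)ᶜ, f z ≠ 0) (hmer : ∀ z, MeromorphicAt f z)
    (hinf : MeromorphicAt (fun z => f z⁻¹) 0) :
    ∃ (c : ℂ) (a b : ℤ), ∀ z ∈ ({0, 1} : Set ℂ)ᶜ, f z = c * z ^ a * (z - 1) ^ b := by
  have hord : ∀ z, meromorphicOrderAt f z ≠ ⊤ := by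
    intro z
    rw [meromorphicOrderAt_ne_top_iff_eventually_ne_zero (hmer z)]
    filter_upwards [aux_ev z] with x hx using hne x hx
  have han : ∀ z ∈ ({0, 1} : Set ℂ)ᶜ, AnalyticAt ℂ f z := fun z hz =>
    hf.analyticAt (aux_open.mem_nhds hz)
  have hmer' : MeromorphicOn f univ := fun z _ => hmer z
  have hdiv : ∀ z ∈ ({0, 1} : Set ℂ)ᶜ, MeromorphicOn.divisor f univ z = 0 := by
    intro z hz
    rw [MeromorphicOn.divisor_apply hmer' (mem_univ z), (han z hz).meromorphicOrderAt_eq,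
      (han z hz).analyticOrderAt_eq_zero.2 (hne z hz)]
    rfl
  have hsupp : (MeromorphicOn.divisor f univ).support ⊆ {0, 1} := by
    intro z hz
    by_contra h
    exact hz (hdiv z h)
  obtain ⟨g, hg, hg0, hfg⟩ := hmer'.extract_zeros_poles (fun u => hord u)
    (((Set.finite_singleton (1:ℂ)).insert 0).subset hsupp)
  set a := MeromorphicOn.divisor f univ 0
  set b := MeromorphicOn.divisor f univ 1
  have hprod : (∏ᶠ u, ((· - u) : ℂ → ℂ) ^ (MeromorphicOn.divisor f univ u)) =
      fun z => z ^ a * (z - 1) ^ b := by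
    rw [finprod_eq_prod_of_mulSupport_subset (s := {0, 1})]
    · rw [Finset.prod_pair (by simp)]
      ext z; simp [a, b]
    · intro u hu
      by_contra h
      apply hu
      have h' := hdiv u (by simpa using h)
      simp only [h', zpow_zero]
  rw [hprod] at hfg
  have hpt : ∀ z ∈ ({0, 1} : Set ℂ)ᶜ, f z = z ^ a * (z - 1) ^ b * g z := by
    intro z hz
    have h1 : f =ᶠ[𝓝[≠] z] fun z => z ^ a * (z - 1) ^ b * g z := by
      have := mem_codiscreteWithin_iff_forall_mem_nhdsNE.1 hfg z (mem_univ z)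
      simp only [compl_univ, union_empty] at this
      filter_upwards [this] with x hx
      exact hx
    have hz' : z ≠ 0 ∧ z - 1 ≠ 0 := by
      simp only [mem_compl_iff, mem_insert_iff, mem_singleton_iff, not_or] at hz
      exact ⟨hz.1, sub_ne_zero.2 hz.2⟩
    refine ((ContinuousAt.eventuallyEq_nhds_iff_eventuallyEq_nhdsNE
      (han z hz).continuousAt ?_).1 h1).eq_of_nhds
    have hgc := (hg z (mem_univ z)).continuousAt
    refine (ContinuousAt.mul ?_ ?_).mul hgc
    · exact continuousAt_zpow₀ z a (Or.inl hz'.1)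
    · exact (continuousAt_id.sub continuousAt_const).zpow₀ b (Or.inl hz'.2)
  have hgi : MeromorphicAt (fun z => g z⁻¹) 0 := by
    have h1 : MeromorphicAt (fun z : ℂ => f z⁻¹ / (z⁻¹ ^ a * (z⁻¹ - 1) ^ b)) 0 := by
      have hi : MeromorphicAt (fun z : ℂ => z⁻¹) 0 := (MeromorphicAt.id (0:ℂ)).inv
      exact hinf.div ((hi.zpow a).mul ((hi.sub (MeromorphicAt.const 1 0)).zpow b))
    refine h1.congr ?_
    filter_upwards [aux_ev 0] with z hz
    simp only [mem_compl_iff, mem_insert_iff, mem_singleton_iff, not_or] at hz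
    rw [hpt z⁻¹ (by simpa using hz)]
    have e1 : z⁻¹ ≠ 0 := by simpa using hz.1
    have e2 : z⁻¹ - 1 ≠ 0 := sub_ne_zero.2 (by simpa using hz.2)
    exact mul_div_cancel_left₀ _ (mul_ne_zero (zpow_ne_zero a e1) (zpow_ne_zero b e2))
  have hgd : Differentiable ℂ g := fun z => (hg z (mem_univ z)).differentiableAt
  have hgn : ∀ z, g z ≠ 0 := fun z => hg0 ⟨z, mem_univ z⟩
  have hconst : ∃ c, ∀ z, g z = c := by
    rcases lt_or_ge (meromorphicOrderAt (fun z => g z⁻¹) 0) 0 with ho | ho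
    · have h1 := (tendsto_cobounded_of_meromorphicOrderAt_neg ho).comp tendsto_inv₀_cobounded'
      have h2 : Tendsto (fun z => (g z)⁻¹) (cocompact ℂ) (𝓝 0) := by
        rw [← Metric.cobounded_eq_cocompact]
        refine (tendsto_inv₀_cobounded.comp h1).congr ?_
        intro z; simp
      have h3 : Differentiable ℂ (fun z => (g z)⁻¹) := fun z => (hgd z).inv (hgn z)
      have := h3.eq_const_of_tendsto_cocompact h2
      exact absurd (congrFun this 0) (by simp [hgn 0])
    · obtain ⟨c, hc⟩ := tendsto_nhds_of_meromorphicOrderAt_nonneg hgi ho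
      have h1 := hc.comp tendsto_inv₀_cobounded'
      have h2 : Tendsto g (cocompact ℂ) (𝓝 c) := by
        rw [← Metric.cobounded_eq_cocompact]
        refine h1.congr ?_
        intro z; simp
      exact ⟨c, fun z => congrFun (hgd.eq_const_of_tendsto_cocompact h2) z⟩
  obtain ⟨c, hc⟩ := hconst
  exact ⟨c, a, b, fun z hz => by rw [hpt z hz, hc z]; ring⟩

lemma aux_logd (f : ℂ → ℂ) (c : ℂ) (a b : ℤ)
    (h : ∀ z ∈ ({0, 1} : Set ℂ)ᶜ, f z = c * z ^ a * (z - 1) ^ b) :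
    ∀ z ∈ ({0, 1} : Set ℂ)ᶜ, deriv f z * (z * (z - 1)) = f z * ((a + b) * z - a) := by
  intro z hz
  have hz' : z ≠ 0 ∧ z - 1 ≠ 0 := by
    simp only [mem_compl_iff, mem_insert_iff, mem_singleton_iff, not_or] at hz
    exact ⟨hz.1, sub_ne_zero.2 hz.2⟩
  have h1 := (hasDerivAt_zpow a z (Or.inl hz'.1)).const_mul c
  have h2 := (hasDerivAt_zpow b (z-1) (Or.inl hz'.2)).comp_sub_const z 1
  have h3 := h1.mul h2
  have h4 : HasDerivAt f _ z := h3.congr_of_eventuallyEq (by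
    filter_upwards [aux_open.mem_nhds hz] with x hx
    simpa using h x hx)
  rw [h4.deriv, h z hz, zpow_sub_one₀ hz'.1, zpow_sub_one₀ hz'.2]
  have e1 := hz'.1
  have e2 := hz'.2
  field_simp
  ring

open Filter Topology in
lemma aux_class (f : ℂ → ℂ) (hf : DifferentiableOn ℂ f ({0, 1} : Set ℂ)ᶜ)
    (hm : MapsTo f ({0, 1} : Set ℂ)ᶜ ({0, 1} : Set ℂ)ᶜ)
    (hnc : ¬ ∃ c : ℂ, ∀ z ∈ ({0, 1} : Set ℂ)ᶜ, f z = c) (α β γ δ : ℂ)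
    (h0 : ¬ (α = 0 ∧ β = 0))
    (h : ∀ z ∈ ({0, 1} : Set ℂ)ᶜ, f z * (γ * z + δ) = α * z + β) :
    (∀ z ∈ ({0, 1} : Set ℂ)ᶜ, f z = z) ∨
    (∀ z ∈ ({0, 1} : Set ℂ)ᶜ, f z = 1 - z) ∨
    (∀ z ∈ ({0, 1} : Set ℂ)ᶜ, f z = z⁻¹) ∨
    (∀ z ∈ ({0, 1} : Set ℂ)ᶜ, f z = (1 - z)⁻¹) ∨
    (∀ z ∈ ({0, 1} : Set ℂ)ᶜ, f z = z / (z - 1)) ∨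
    (∀ z ∈ ({0, 1} : Set ℂ)ᶜ, f z = (z - 1) / z) := by
  have hγδ : ¬ (γ = 0 ∧ δ = 0) := by
    rintro ⟨rfl, rfl⟩
    have h2 := h 2 (by simp)
    have h3 := h 3 (by simp)
    have hα : α = 0 := by linear_combination h2 - h3
    exact h0 ⟨hα, by rw [hα] at h2; linear_combination -h2⟩
  have hdet : α * δ - β * γ ≠ 0 := by
    intro hd
    obtain ⟨k, hk1, hk2⟩ : ∃ k, α = k * γ ∧ β = k * δ := by
      by_cases hγ : γ = 0
      · have hδ : δ ≠ 0 := fun hδ => hγδ ⟨hγ, hδ⟩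
        refine ⟨β / δ, ?_, by field_simp⟩
        rw [hγ] at hd ⊢
        have : α * δ = 0 := by linear_combination hd
        simpa [hδ] using this
      · refine ⟨α / γ, by field_simp, ?_⟩
        field_simp; linear_combination -hd
    apply hnc
    refine ⟨k, fun z hz => ?_⟩
    have hroot : ∀ᶠ x in 𝓝[≠] z, γ * x + δ ≠ 0 := by
      by_cases hγ : γ = 0
      · have hδ : δ ≠ 0 := fun hδ => hγδ ⟨hγ, hδ⟩
        exact Eventually.of_forall (fun x => by simp [hγ, hδ])
      · have h1 : (({-δ/γ} : Set ℂ) \ {z})ᶜ ∈ 𝓝 z :=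
          IsOpen.mem_nhds (((Set.finite_singleton _).subset sdiff_subset).isClosed.isOpen_compl)
            (by simp)
        filter_upwards [mem_nhdsWithin_of_mem_nhds h1, self_mem_nhdsWithin] with x hx hxz h2
        refine hx ⟨?_, hxz⟩
        rw [mem_singleton_iff]; field_simp; linear_combination h2
    have h1 : f =ᶠ[𝓝[≠] z] fun _ => k := by
      filter_upwards [hroot, aux_ev z] with x hx hx2
      have := h x hx2
      rw [hk1, hk2] at this
      exact mul_right_cancel₀ hx (by linear_combination this)
    exact ((ContinuousAt.eventuallyEq_nhds_iff_eventuallyEq_nhdsNE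
      (hf.differentiableAt (aux_open.mem_nhds hz)).continuousAt continuousAt_const).1 h1).eq_of_nhds
  have hv : ∀ z ∈ ({0, 1} : Set ℂ)ᶜ, f z ≠ 0 ∧ f z ≠ 1 := by
    intro z hz
    have := hm hz
    simpa [not_or] using this
  have hroot : ∀ u v : ℂ, u ≠ 0 → v ≠ 0 → v ≠ -u → (-v / u) ∈ ({0, 1} : Set ℂ)ᶜ := by
    intro u v hu hv huv
    simp only [mem_compl_iff, mem_insert_iff, mem_singleton_iff, not_or]
    refine ⟨div_ne_zero (neg_ne_zero.2 hv) hu, ?_⟩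
    intro h; rw [div_eq_one_iff_eq hu] at h
    exact huv (by linear_combination -h)
  have c1 : α = 0 ∨ β = 0 ∨ β = -α := by
    by_contra! hc
    have hz := hroot α β hc.1 hc.2.1 hc.2.2
    have h1 := h _ hz
    have hα := hc.1
    have e : α * (-β / α) + β = 0 := by field_simp; ring
    rw [e] at h1
    have h2 := (mul_eq_zero.1 h1).resolve_left (hv _ hz).1
    apply hdet
    field_simp at h2
    linear_combination h2
  have c2 : γ = 0 ∨ δ = 0 ∨ δ = -γ := by
    by_contra! hc
    have hz := hroot γ δ hc.1 hc.2.1 hc.2.2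
    have h1 := h _ hz
    have hα := hc.1
    have e : γ * (-δ / γ) + δ = 0 := by field_simp; ring
    rw [e, mul_zero] at h1
    apply hdet
    field_simp at h1
    linear_combination h1
  have c3 : α - γ = 0 ∨ β - δ = 0 ∨ β - δ = -(α - γ) := by
    by_contra! hc
    have hz := hroot (α - γ) (β - δ) hc.1 hc.2.1 hc.2.2
    have h1 := h _ hz
    have hα := hc.1
    have e : (α - γ) * (-(β - δ) / (α - γ)) + (β - δ) = 0 := by field_simp; ring
    have e1 : (f (-(β - δ) / (α - γ)) - 1) * (γ * (-(β - δ) / (α - γ)) + δ) = 0 := by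
      linear_combination h1 + e
    have h2 := (mul_eq_zero.1 e1).resolve_left (sub_ne_zero.2 (hv _ hz).2)
    apply hdet
    field_simp at h2
    linear_combination h2
  have hU : ∀ z ∈ ({0, 1} : Set ℂ)ᶜ, z ≠ 0 ∧ z ≠ 1 := by
    intro z hz; simpa [not_or] using hz
  rcases c1 with rfl | rfl | rfl <;> rcases c2 with rfl | rfl | rfl
  · simp at hdet
  · have hβ : β = γ := by grind
    have : γ ≠ 0 := by grind
    right; right; left
    intro z hz; have := h z hz; have := hU z hz; grind
  · have hβ : β = -γ := by grind
    have : γ ≠ 0 := by grind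
    right; right; right; left
    intro z hz; have := h z hz; have := hU z hz; grind
  · have hβ : α = δ := by grind
    have : δ ≠ 0 := by grind
    left
    intro z hz; have := h z hz; have := hU z hz; grind
  · simp at hdet
  · have hβ : α = γ := by grind
    have : γ ≠ 0 := by grind
    right; right; right; right; left
    intro z hz; have := h z hz; have := hU z hz; grind
  · have hβ : δ = -α := by grind
    have : α ≠ 0 := by grind
    right; left
    intro z hz; have := h z hz; have := hU z hz; grind
  · have hβ : α = γ := by grind
    have : γ ≠ 0 := by grind
    right; right; right; right; right
    intro z hz; have := h z hz; have := hU z hz; grind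
  · exact absurd (by ring) hdet

lemma aux_main (f : ℂ → ℂ) (hf : DifferentiableOn ℂ f ({0, 1} : Set ℂ)ᶜ)
    (hm : MapsTo f ({0, 1} : Set ℂ)ᶜ ({0, 1} : Set ℂ)ᶜ)
    (hnc : ¬ ∃ c : ℂ, ∀ z ∈ ({0, 1} : Set ℂ)ᶜ, f z = c) :
    (∀ z ∈ ({0, 1} : Set ℂ)ᶜ, f z = z) ∨
    (∀ z ∈ ({0, 1} : Set ℂ)ᶜ, f z = 1 - z) ∨
    (∀ z ∈ ({0, 1} : Set ℂ)ᶜ, f z = z⁻¹) ∨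
    (∀ z ∈ ({0, 1} : Set ℂ)ᶜ, f z = (1 - z)⁻¹) ∨
    (∀ z ∈ ({0, 1} : Set ℂ)ᶜ, f z = z / (z - 1)) ∨
    (∀ z ∈ ({0, 1} : Set ℂ)ᶜ, f z = (z - 1) / z) := by
  have hv : ∀ z ∈ ({0, 1} : Set ℂ)ᶜ, f z ≠ 0 ∧ f z ≠ 1 := by
    intro z hz
    have := hm hz
    simpa [not_or] using this
  have hmer := aux_mero f hf hm
  have hinf := aux_mero_inf f hf hm
  obtain ⟨c, a, b, h1⟩ := aux_factor f hf (fun z hz => (hv z hz).1) hmer hinf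
  obtain ⟨d, p, q, h2⟩ := aux_factor (fun z => f z - 1) (hf.sub_const 1)
    (fun z hz => sub_ne_zero.2 (hv z hz).2) (fun z => (hmer z).sub (MeromorphicAt.const 1 z))
    (hinf.sub (MeromorphicAt.const 1 0))
  have l1 := aux_logd f c a b h1
  have l2 := aux_logd _ d p q h2
  refine aux_class f hf hm hnc (-(p + q)) p (a + b - (p + q)) (p - a) ?_ ?_
  · rintro ⟨h3, h4⟩
    have hp : p = 0 := by exact_mod_cast h4
    have hq : q = 0 := by
      rw [h4] at h3
      have : (q : ℂ) = 0 := by linear_combination -h3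
      exact_mod_cast this
    apply hnc
    refine ⟨d + 1, fun z hz => ?_⟩
    have := h2 z hz
    rw [hp, hq] at this
    simp only [zpow_zero, mul_one] at this
    linear_combination this
  · intro z hz
    have e1 := l1 z hz
    have e2 := l2 z hz
    have : deriv (fun z => f z - 1) z = deriv f z := deriv_sub_const 1
    rw [this] at e2
    linear_combination e2 - e1


/-- A function on `ℂ ∖ {0,1}` agreeing with the six maps; used to verify membership. -/
lemma aux_nc (h : ℂ → ℂ) (h1 : h 3 ≠ h (-1)) :
    ¬ ∃ c : ℂ, ∀ z ∈ ({0, 1} : Set ℂ)ᶜ, h z = c := by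
  rintro ⟨c, hc⟩
  exact h1 (by rw [hc 3 (by simp), hc (-1) (by simp; norm_num)])

lemma aux_mem (z : ℂ) : z ∈ ({0, 1} : Set ℂ)ᶜ ↔ z ≠ 0 ∧ z ≠ 1 := by
  simp [not_or]

lemma aux_sub {z : ℂ} (hz : z ∈ ({0, 1} : Set ℂ)ᶜ) :
    z ≠ 0 ∧ z ≠ 1 ∧ 1 - z ≠ 0 ∧ z - 1 ≠ 0 := by
  rw [aux_mem] at hz
  exact ⟨hz.1, hz.2, sub_ne_zero.2 (Ne.symm hz.2), sub_ne_zero.2 hz.2⟩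

lemma aux_maps :
    MapsTo (fun z : ℂ => z) ({0, 1} : Set ℂ)ᶜ ({0, 1} : Set ℂ)ᶜ ∧
    MapsTo (fun z : ℂ => 1 - z) ({0, 1} : Set ℂ)ᶜ ({0, 1} : Set ℂ)ᶜ ∧
    MapsTo (fun z : ℂ => z⁻¹) ({0, 1} : Set ℂ)ᶜ ({0, 1} : Set ℂ)ᶜ ∧
    MapsTo (fun z : ℂ => (1 - z)⁻¹) ({0, 1} : Set ℂ)ᶜ ({0, 1} : Set ℂ)ᶜ ∧
    MapsTo (fun z : ℂ => z / (z - 1)) ({0, 1} : Set ℂ)ᶜ ({0, 1} : Set ℂ)ᶜ ∧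
    MapsTo (fun z : ℂ => (z - 1) / z) ({0, 1} : Set ℂ)ᶜ ({0, 1} : Set ℂ)ᶜ := by
  refine ⟨?_, ?_, ?_, ?_, ?_, ?_⟩ <;> intro z hz <;>
    obtain ⟨h1, h2, h3, h4⟩ := aux_sub hz <;> rw [aux_mem] <;> grind

lemma aux_diff :
    DifferentiableOn ℂ (fun z : ℂ => z) ({0, 1} : Set ℂ)ᶜ ∧
    DifferentiableOn ℂ (fun z : ℂ => 1 - z) ({0, 1} : Set ℂ)ᶜ ∧
    DifferentiableOn ℂ (fun z : ℂ => z⁻¹) ({0, 1} : Set ℂ)ᶜ ∧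
    DifferentiableOn ℂ (fun z : ℂ => (1 - z)⁻¹) ({0, 1} : Set ℂ)ᶜ ∧
    DifferentiableOn ℂ (fun z : ℂ => z / (z - 1)) ({0, 1} : Set ℂ)ᶜ ∧
    DifferentiableOn ℂ (fun z : ℂ => (z - 1) / z) ({0, 1} : Set ℂ)ᶜ := by
  refine ⟨?_, ?_, ?_, ?_, ?_, ?_⟩ <;> intro z hz <;>
    obtain ⟨h1, h2, h3, h4⟩ := aux_sub hz <;>
    refine DifferentiableAt.differentiableWithinAt ?_
  · fun_prop
  · fun_prop
  · exact differentiableAt_inv h1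
  · exact DifferentiableAt.inv (by fun_prop) h3
  · exact DifferentiableAt.div (by fun_prop) (by fun_prop) h4
  · exact DifferentiableAt.div (by fun_prop) (by fun_prop) h1

lemma aux_set :
    ({f : ↥(({0, 1} : Set ℂ)ᶜ) → ℂ | ∃ h : ℂ → ℂ,
        DifferentiableOn ℂ h ({0, 1} : Set ℂ)ᶜ ∧
        MapsTo h ({0, 1} : Set ℂ)ᶜ ({0, 1} : Set ℂ)ᶜ ∧
        (¬ ∃ c : ℂ, ∀ z ∈ ({0, 1} : Set ℂ)ᶜ, h z = c) ∧
        (∀ x : ↥(({0, 1} : Set ℂ)ᶜ), f x = h x)} =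
      ({(fun x : ↥(({0, 1} : Set ℂ)ᶜ) => (x : ℂ)),
        (fun x : ↥(({0, 1} : Set ℂ)ᶜ) => 1 - (x : ℂ)),
        (fun x : ↥(({0, 1} : Set ℂ)ᶜ) => (x : ℂ)⁻¹),
        (fun x : ↥(({0, 1} : Set ℂ)ᶜ) => (1 - (x : ℂ))⁻¹),
        (fun x : ↥(({0, 1} : Set ℂ)ᶜ) => (x : ℂ) / ((x : ℂ) - 1)),
        (fun x : ↥(({0, 1} : Set ℂ)ᶜ) => ((x : ℂ) - 1) / (x : ℂ))} :
        Set (↥(({0, 1} : Set ℂ)ᶜ) → ℂ))) := by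
  obtain ⟨m1, m2, m3, m4, m5, m6⟩ := aux_maps
  obtain ⟨d1, d2, d3, d4, d5, d6⟩ := aux_diff
  apply Subset.antisymm
  · rintro f ⟨h, hd, hm, hnc, hfh⟩
    simp only [mem_insert_iff, mem_singleton_iff]
    rcases aux_main h hd hm hnc with H | H | H | H | H | H
    · exact Or.inl (funext fun x => by rw [hfh x, H x x.2])
    · exact Or.inr (Or.inl (funext fun x => by rw [hfh x, H x x.2]))
    · exact Or.inr (Or.inr (Or.inl (funext fun x => by rw [hfh x, H x x.2])))
    · exact Or.inr (Or.inr (Or.inr (Or.inl (funext fun x => by rw [hfh x, H x x.2]))))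
    · exact Or.inr (Or.inr (Or.inr (Or.inr (Or.inl (funext fun x => by rw [hfh x, H x x.2])))))
    · exact Or.inr (Or.inr (Or.inr (Or.inr (Or.inr (funext fun x => by rw [hfh x, H x x.2])))))
  · rintro f (rfl | rfl | rfl | rfl | rfl | rfl)
    · exact ⟨fun z => z, d1, m1, aux_nc _ (by norm_num), fun _ => rfl⟩
    · exact ⟨fun z => 1 - z, d2, m2, aux_nc _ (by norm_num), fun _ => rfl⟩
    · exact ⟨fun z => z⁻¹, d3, m3, aux_nc _ (by norm_num), fun _ => rfl⟩
    · exact ⟨fun z => (1 - z)⁻¹, d4, m4, aux_nc _ (by norm_num), fun _ => rfl⟩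
    · exact ⟨fun z => z / (z - 1), d5, m5, aux_nc _ (by norm_num), fun _ => rfl⟩
    · exact ⟨fun z => (z - 1) / z, d6, m6, aux_nc _ (by norm_num), fun _ => rfl⟩

lemma aux_ncard :
      ({(fun x : ↥(({0, 1} : Set ℂ)ᶜ) => (x : ℂ)),
        (fun x : ↥(({0, 1} : Set ℂ)ᶜ) => 1 - (x : ℂ)),
        (fun x : ↥(({0, 1} : Set ℂ)ᶜ) => (x : ℂ)⁻¹),
        (fun x : ↥(({0, 1} : Set ℂ)ᶜ) => (1 - (x : ℂ))⁻¹),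
        (fun x : ↥(({0, 1} : Set ℂ)ᶜ) => (x : ℂ) / ((x : ℂ) - 1)),
        (fun x : ↥(({0, 1} : Set ℂ)ᶜ) => ((x : ℂ) - 1) / (x : ℂ))} :
        Set (↥(({0, 1} : Set ℂ)ᶜ) → ℂ)).ncard = 6 := by
  have key : ∀ f g : ↥(({0, 1} : Set ℂ)ᶜ) → ℂ, f ⟨3, by simp⟩ ≠ g ⟨3, by simp⟩ → f ≠ g := by
    rintro f g h rfl
    exact h rfl
  rw [ncard_insert_of_notMem, ncard_insert_of_notMem, ncard_insert_of_notMem,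
    ncard_insert_of_notMem, ncard_pair]
  · apply key; norm_num
  all_goals
    simp only [mem_insert_iff, mem_singleton_iff, not_or]
    refine_lift ?_
    repeat' apply And.intro
    all_goals apply key; norm_num

lemma aux_aut : ∀ h : ℂ → ℂ, DifferentiableOn ℂ h ({0, 1} : Set ℂ)ᶜ →
      MapsTo h ({0, 1} : Set ℂ)ᶜ ({0, 1} : Set ℂ)ᶜ →
      (¬ ∃ c : ℂ, ∀ z ∈ ({0, 1} : Set ℂ)ᶜ, h z = c) →
      ∃ g : ℂ → ℂ, DifferentiableOn ℂ g ({0, 1} : Set ℂ)ᶜ ∧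
        MapsTo g ({0, 1} : Set ℂ)ᶜ ({0, 1} : Set ℂ)ᶜ ∧
        (∀ z ∈ ({0, 1} : Set ℂ)ᶜ, g (h z) = z) ∧
        (∀ z ∈ ({0, 1} : Set ℂ)ᶜ, h (g z) = z) := by
  intro h hd hm hnc
  obtain ⟨m1, m2, m3, m4, m5, m6⟩ := aux_maps
  obtain ⟨d1, d2, d3, d4, d5, d6⟩ := aux_diff
  rcases aux_main h hd hm hnc with H | H | H | H | H | H
  · refine ⟨_, d1, m1, fun z hz => H z hz, fun z hz => H z hz⟩
  · refine ⟨_, d2, m2, fun z hz => ?_, fun z hz => ?_⟩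
    · simp only [H z hz]; ring
    · rw [H _ (m2 hz)]; ring
  · refine ⟨_, d3, m3, fun z hz => ?_, fun z hz => ?_⟩
    · simp only [H z hz, inv_inv]
    · rw [H _ (m3 hz)]; simp
  · refine ⟨_, d6, m6, fun z hz => ?_, fun z hz => ?_⟩
    · obtain ⟨h1, h2, h3, h4⟩ := aux_sub hz
      simp only [H z hz]; grind
    · obtain ⟨h1, h2, h3, h4⟩ := aux_sub hz
      rw [H _ (m6 hz)]; grind
  · refine ⟨_, d5, m5, fun z hz => ?_, fun z hz => ?_⟩
    · obtain ⟨h1, h2, h3, h4⟩ := aux_sub hz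
      simp only [H z hz]; grind
    · obtain ⟨h1, h2, h3, h4⟩ := aux_sub hz
      rw [H _ (m5 hz)]; grind
  · refine ⟨_, d4, m4, fun z hz => ?_, fun z hz => ?_⟩
    · obtain ⟨h1, h2, h3, h4⟩ := aux_sub hz
      simp only [H z hz]; grind
    · obtain ⟨h1, h2, h3, h4⟩ := aux_sub hz
      rw [H _ (m4 hz)]; grind




/-- The set of nonconstant holomorphic self-maps of `ℂ ∖ {0,1}` (recorded as functions on the
subtype `↥({0,1}ᶜ)`) consists of exactly the six Möbius transformations permuting `{0, 1, ∞}`;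
in particular it has exactly six elements, it is finite, and every nonconstant holomorphic
self-map of `ℂ ∖ {0,1}` is an automorphism. -/
theorem nonconstant_selfmaps_of_twice_punctured_plane :
    ({f : ↥(({0, 1} : Set ℂ)ᶜ) → ℂ | ∃ h : ℂ → ℂ,
        DifferentiableOn ℂ h ({0, 1} : Set ℂ)ᶜ ∧
        MapsTo h ({0, 1} : Set ℂ)ᶜ ({0, 1} : Set ℂ)ᶜ ∧
        (¬ ∃ c : ℂ, ∀ z ∈ ({0, 1} : Set ℂ)ᶜ, h z = c) ∧
        (∀ x : ↥(({0, 1} : Set ℂ)ᶜ), f x = h x)} =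
      ({(fun x : ↥(({0, 1} : Set ℂ)ᶜ) => (x : ℂ)),
        (fun x : ↥(({0, 1} : Set ℂ)ᶜ) => 1 - (x : ℂ)),
        (fun x : ↥(({0, 1} : Set ℂ)ᶜ) => (x : ℂ)⁻¹),
        (fun x : ↥(({0, 1} : Set ℂ)ᶜ) => (1 - (x : ℂ))⁻¹),
        (fun x : ↥(({0, 1} : Set ℂ)ᶜ) => (x : ℂ) / ((x : ℂ) - 1)),
        (fun x : ↥(({0, 1} : Set ℂ)ᶜ) => ((x : ℂ) - 1) / (x : ℂ))} :
        Set (↥(({0, 1} : Set ℂ)ᶜ) → ℂ))) ∧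
    {f : ↥(({0, 1} : Set ℂ)ᶜ) → ℂ | ∃ h : ℂ → ℂ,
        DifferentiableOn ℂ h ({0, 1} : Set ℂ)ᶜ ∧
        MapsTo h ({0, 1} : Set ℂ)ᶜ ({0, 1} : Set ℂ)ᶜ ∧
        (¬ ∃ c : ℂ, ∀ z ∈ ({0, 1} : Set ℂ)ᶜ, h z = c) ∧
        (∀ x : ↥(({0, 1} : Set ℂ)ᶜ), f x = h x)}.ncard = 6 ∧
    {f : ↥(({0, 1} : Set ℂ)ᶜ) → ℂ | ∃ h : ℂ → ℂ,
        DifferentiableOn ℂ h ({0, 1} : Set ℂ)ᶜ ∧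
        MapsTo h ({0, 1} : Set ℂ)ᶜ ({0, 1} : Set ℂ)ᶜ ∧
        (¬ ∃ c : ℂ, ∀ z ∈ ({0, 1} : Set ℂ)ᶜ, h z = c) ∧
        (∀ x : ↥(({0, 1} : Set ℂ)ᶜ), f x = h x)}.Finite ∧
    ∀ h : ℂ → ℂ, DifferentiableOn ℂ h ({0, 1} : Set ℂ)ᶜ →
      MapsTo h ({0, 1} : Set ℂ)ᶜ ({0, 1} : Set ℂ)ᶜ →
      (¬ ∃ c : ℂ, ∀ z ∈ ({0, 1} : Set ℂ)ᶜ, h z = c) →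
      ∃ g : ℂ → ℂ, DifferentiableOn ℂ g ({0, 1} : Set ℂ)ᶜ ∧
        MapsTo g ({0, 1} : Set ℂ)ᶜ ({0, 1} : Set ℂ)ᶜ ∧
        (∀ z ∈ ({0, 1} : Set ℂ)ᶜ, g (h z) = z) ∧
        (∀ z ∈ ({0, 1} : Set ℂ)ᶜ, h (g z) = z) := by

  refine ⟨aux_set, ?_, ?_, aux_aut⟩
  · rw [aux_set]; exact aux_ncard
  · rw [aux_set]; exact Set.toFinite _
end
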